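/- The image of the function f_0 + f_1 in the quotient (ind_K^G 1)/(T+1) is nonzero, but it does not generate (ind_K^G 1)/(T+1) as a representation of G. -/

import Mathlib

open scoped Classical

noncomputable section

namespace U21

/-- The arithmetic setting: `E` is the unramified quadratic extension of a non-archimedean
local field `F` of odd residue characteristic `p`, with residue field of `F` of cardinality
`q = p ^ fdeg`.  The field `E` is encoded through its valuation subring `O = o_E`, a
uniformizer `ϖ`, the maximal ideal `mI` (so that `p_E^k` is `ϖ ^ k * O`), and the nontrivial
`F`-automorphism `conj` of `E` (which induces the `q`-power Frobenius on the residue field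
of `E`, of cardinality `q ^ 2`). -/
structure Setting where
  p : ℕ
  q : ℕ
  fdeg : ℕ
  hp : p.Prime
  hodd : p ≠ 2
  hfdeg : 0 < fdeg
  hq : q = p ^ fdeg
  E : Type
  [fieldE : Field E]
  conj : E →+* E
  conj_invol : ∀ x, conj (conj x) = x
  conj_ne : conj ≠ RingHom.id E
  O : Subring E
  val_ring : ∀ x : E, x ≠ 0 → x ∈ O ∨ x⁻¹ ∈ O
  conj_O : ∀ x, x ∈ O → conj x ∈ O
  ϖ : E
  unif_mem : ϖ ∈ O
  unif_ne : ϖ ≠ 0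
  unif_conj : conj ϖ = ϖ
  unif_not_unit : ¬ IsUnit (⟨ϖ, unif_mem⟩ : O)
  disc : ∀ x : E, x ≠ 0 → ∃ (n : ℤ) (u : Oˣ), x = (u : O) * ϖ ^ n
  mI : Ideal O
  hmI : ∀ x : O, x ∈ mI ↔ ∃ y ∈ O, (x : E) = ϖ * y
  [fin_res : Fintype (O ⧸ mI)]
  card_res : Fintype.card (O ⧸ mI) = q ^ 2
  res_frob : ∀ x : O, Ideal.Quotient.mk mI ⟨conj x, conj_O x x.2⟩ = (Ideal.Quotient.mk mI x) ^ q
  complete : ∀ a : ℕ → E,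
    (∀ k : ℕ, ∃ N, ∀ m ≥ N, ∀ n ≥ N, ∃ w ∈ O, a m - a n = ϖ ^ k * w) →
    ∃ L : E, ∀ k : ℕ, ∃ N, ∀ n ≥ N, ∃ w ∈ O, a n - L = ϖ ^ k * w

attribute [instance] Setting.fieldE Setting.fin_res

namespace Setting

variable (S : Setting)

/-- 3×3 matrices over `E`. -/
abbrev M3 := Matrix (Fin 3) (Fin 3) S.E

/-- The antidiagonal matrix `β` of the Hermitian form. -/
def betaM : S.M3 := !![0,0,1;0,1,0;1,0,0]

/-- The fractional ideal `p_E ^ k ⊆ E` (for `k : ℤ`). -/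
def pE (k : ℤ) : Set S.E := {z | ∃ w ∈ S.O, z = S.ϖ ^ k * w}

/-- The unramified unitary group `G = U(2,1)(E/F)`, as a subgroup of `GL₃(E)`:
`g ∈ G` iff `g.transpose * β * conj g = β`. -/
def Gsub : Subgroup (Matrix.GeneralLinearGroup (Fin 3) S.E) where
  carrier := {g | ((g : S.M3)).transpose * S.betaM * ((g : S.M3).map S.conj) = S.betaM}
  one_mem' := by
    simp [Matrix.map_one (⇑S.conj) (map_zero S.conj) (map_one S.conj)]
  mul_mem' := by
    intro a b ha hb
    simp only [Set.mem_setOf_eq, Units.val_mul, Matrix.transpose_mul, Matrix.map_mul] at ha hb ⊢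
    calc ((b : S.M3)).transpose * ((a : S.M3)).transpose * S.betaM * ((a : S.M3).map S.conj * (b : S.M3).map S.conj)
        = ((b : S.M3)).transpose * (((a : S.M3)).transpose * S.betaM * (a : S.M3).map S.conj) * ((b : S.M3).map S.conj) := by
          simp only [mul_assoc]
      _ = S.betaM := by rw [ha]; exact hb
  inv_mem' := by
    intro a ha
    simp only [Set.mem_setOf_eq] at ha ⊢
    have hA : IsUnit ((a : S.M3)) := a.isUnit
    have hdet : IsUnit ((a : S.M3)).det := (Matrix.isUnit_iff_isUnit_det _).mp hA
    have hAc : IsUnit (((a : S.M3)).map ⇑S.conj) := by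
      rw [← RingHom.mapMatrix_apply]; exact hA.map _
    have hdetc : IsUnit ((((a : S.M3)).map ⇑S.conj).det) := (Matrix.isUnit_iff_isUnit_det _).mp hAc
    have hdetT : IsUnit ((((a : S.M3)).transpose).det) := by rw [Matrix.det_transpose]; exact hdet
    have hmapinv : ((a : S.M3)⁻¹).map ⇑S.conj = (((a : S.M3)).map ⇑S.conj)⁻¹ := by
      symm
      apply Matrix.inv_eq_left_inv
      rw [← Matrix.map_mul, Matrix.nonsing_inv_mul _ hdet,
        Matrix.map_one (⇑S.conj) (map_zero S.conj) (map_one S.conj)]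
    rw [Matrix.coe_units_inv, Matrix.transpose_nonsing_inv, hmapinv]
    conv_lhs => rw [← ha]
    calc (((a:S.M3)).transpose)⁻¹ * (((a:S.M3)).transpose * S.betaM * ((a:S.M3)).map ⇑S.conj) * (((a:S.M3)).map ⇑S.conj)⁻¹
        = (((a:S.M3)).transpose)⁻¹ * ((a:S.M3)).transpose * S.betaM *
            (((a:S.M3)).map ⇑S.conj * (((a:S.M3)).map ⇑S.conj)⁻¹) := by simp only [mul_assoc]
      _ = S.betaM := by
          rw [Matrix.nonsing_inv_mul _ hdetT, Matrix.mul_nonsing_inv _ hdetc, one_mul, mul_one]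

/-- The group `G = U(2,1)(E/F)`. -/
abbrev GG := ↥S.Gsub

/-- The matrix of an element of `G`. -/
def mat (g : S.GG) : S.M3 := ((g : Matrix.GeneralLinearGroup (Fin 3) S.E) : S.M3)

/-- The upper unipotent matrix `n(x,y)`. -/
def nM (x y : S.E) : S.M3 := !![1, x, y; 0, 1, -S.conj x; 0, 0, 1]

/-- The lower unipotent matrix `n'(x,y)`. -/
def n'M (x y : S.E) : S.M3 := !![1, 0, 0; x, 1, 0; y, -S.conj x, 1]

/-- The diagonal matrix `h(x) = diag(x, -x̄x⁻¹, x̄⁻¹)`. -/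
def hM (x : S.E) : S.M3 := !![x, 0, 0; 0, -S.conj x * x⁻¹, 0; 0, 0, (S.conj x)⁻¹]

/-- The subgroup `N` of `G` (unipotent radical of the upper triangular Borel), as a set. -/
def Nset : Set S.GG := {g | ∃ x y : S.E, x * S.conj x + y + S.conj y = 0 ∧ S.mat g = S.nM x y}

/-- The subgroup `N_k = {n(x,y) : y ∈ p_E^k}`, as a set. -/
def Nk (k : ℤ) : Set S.GG :=
  {g | ∃ x y : S.E, x * S.conj x + y + S.conj y = 0 ∧ y ∈ S.pE k ∧ S.mat g = S.nM x y}

/-- The subgroup `N'` of `G`, as a set. -/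
def N'set : Set S.GG := {g | ∃ x y : S.E, x * S.conj x + y + S.conj y = 0 ∧ S.mat g = S.n'M x y}

/-- The subgroup `N'_k = {n'(x,y) : y ∈ p_E^k}`, as a set. -/
def N'k (k : ℤ) : Set S.GG :=
  {g | ∃ x y : S.E, x * S.conj x + y + S.conj y = 0 ∧ y ∈ S.pE k ∧ S.mat g = S.n'M x y}

/-- The diagonal subgroup `H` of `G`, as a set. -/
def Hset : Set S.GG := {g | ∃ a b c : S.E, S.mat g = !![a,0,0;0,b,0;0,0,c]}

/-- The hyperspecial maximal compact subgroup `K₀ = G ∩ GL₃(o_E)`, as a set. -/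
def K0set : Set S.GG := {g | ∀ i j, S.mat g i j ∈ S.O}

/-- The special (non-hyperspecial) maximal compact subgroup `K₁`, as a set. -/
def K1set : Set S.GG :=
  {g | S.mat g 0 0 ∈ S.O ∧ S.mat g 0 1 ∈ S.O ∧ S.mat g 0 2 ∈ S.pE (-1) ∧
       S.mat g 1 0 ∈ S.pE 1 ∧ S.mat g 1 1 ∈ S.O ∧ S.mat g 1 2 ∈ S.O ∧
       S.mat g 2 0 ∈ S.pE 1 ∧ S.mat g 2 1 ∈ S.pE 1 ∧ S.mat g 2 2 ∈ S.O}

/-- The Iwahori subgroup `I_{K₀}` (preimage of the Borel of `Γ_{K₀}`), as a set. -/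
def IK0 : Set S.GG :=
  {g | g ∈ S.K0set ∧ S.mat g 1 0 ∈ S.pE 1 ∧ S.mat g 2 0 ∈ S.pE 1 ∧ S.mat g 2 1 ∈ S.pE 1}

/-- The pro-p Iwahori subgroup `I_{1,K₀}`, as a set. -/
def I1K0 : Set S.GG :=
  {g | g ∈ S.IK0 ∧ S.mat g 0 0 - 1 ∈ S.pE 1 ∧ S.mat g 1 1 - 1 ∈ S.pE 1 ∧ S.mat g 2 2 - 1 ∈ S.pE 1}

/-- The opposite pro-p Iwahori subgroup `I'_{1,K₀}`, as a set. -/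
def I1'K0 : Set S.GG :=
  {g | g ∈ S.K0set ∧ S.mat g 0 1 ∈ S.pE 1 ∧ S.mat g 0 2 ∈ S.pE 1 ∧ S.mat g 1 2 ∈ S.pE 1 ∧
       S.mat g 0 0 - 1 ∈ S.pE 1 ∧ S.mat g 1 1 - 1 ∈ S.pE 1 ∧ S.mat g 2 2 - 1 ∈ S.pE 1}

/-- The maximal normal pro-p subgroup `K₀¹` of `K₀` (principal congruence subgroup), as a set. -/
def Kone0 : Set S.GG := {g | ∀ i j, S.mat g i j - (1 : S.M3) i j ∈ S.pE 1}

/-- The Iwahori subgroup `I_{K₁}`, as a set. -/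
def IK1 : Set S.GG := {g | g ∈ S.K1set ∧ S.mat g 2 0 ∈ S.pE 2}

/-- The pro-p Iwahori subgroup `I_{1,K₁}`, as a set. -/
def I1K1 : Set S.GG :=
  {g | g ∈ S.IK1 ∧ S.mat g 0 0 - 1 ∈ S.pE 1 ∧ S.mat g 1 1 - 1 ∈ S.pE 1 ∧ S.mat g 2 2 - 1 ∈ S.pE 1}

/-- The opposite pro-p Iwahori subgroup `I'_{1,K₁}`, as a set. -/
def I1'K1 : Set S.GG :=
  {g | g ∈ S.K1set ∧ S.mat g 0 2 ∈ S.O ∧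
       S.mat g 0 0 - 1 ∈ S.pE 1 ∧ S.mat g 1 1 - 1 ∈ S.pE 1 ∧ S.mat g 2 2 - 1 ∈ S.pE 1}

/-- The maximal normal pro-p subgroup `K₁¹` of `K₁`, as a set. -/
def Kone1 : Set S.GG :=
  {g | g ∈ S.K1set ∧ S.mat g 0 2 ∈ S.O ∧ S.mat g 2 0 ∈ S.pE 2 ∧
       S.mat g 0 0 - 1 ∈ S.pE 1 ∧ S.mat g 1 1 - 1 ∈ S.pE 1 ∧ S.mat g 2 2 - 1 ∈ S.pE 1}

/-- The congruence subgroup of level `n` (used to express smoothness), as a set. -/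
def cong (n : ℕ) : Set S.GG := {g | ∀ i j, S.mat g i j - (1 : S.M3) i j ∈ S.pE n}

def alphaM : S.M3 := !![S.ϖ⁻¹, 0, 0; 0, 1, 0; 0, 0, S.ϖ]

def alphaMinv : S.M3 := !![S.ϖ, 0, 0; 0, 1, 0; 0, 0, S.ϖ⁻¹]

lemma alpha_mul_inv : S.alphaM * S.alphaMinv = 1 := by
  ext i j
  fin_cases i <;> fin_cases j <;>
    simp [alphaM, alphaMinv, Matrix.mul_apply, Fin.sum_univ_three, Matrix.one_apply,
      Matrix.vecHead, Matrix.vecTail, inv_mul_cancel₀ S.unif_ne, mul_inv_cancel₀ S.unif_ne]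

lemma alpha_inv_mul : S.alphaMinv * S.alphaM = 1 := by
  ext i j
  fin_cases i <;> fin_cases j <;>
    simp [alphaM, alphaMinv, Matrix.mul_apply, Fin.sum_univ_three, Matrix.one_apply,
      Matrix.vecHead, Matrix.vecTail, inv_mul_cancel₀ S.unif_ne, mul_inv_cancel₀ S.unif_ne]

def alphaU : Matrix.GeneralLinearGroup (Fin 3) S.E :=
  ⟨S.alphaM, S.alphaMinv, S.alpha_mul_inv, S.alpha_inv_mul⟩

lemma alphaU_mem : S.alphaU ∈ S.Gsub := by
  show ((S.alphaU : S.M3)).transpose * S.betaM * ((S.alphaU : S.M3).map S.conj) = S.betaM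
  have : (S.alphaU : S.M3) = S.alphaM := rfl
  rw [this]
  ext i j
  fin_cases i <;> fin_cases j <;>
    simp [alphaM, betaM, Matrix.mul_apply, Fin.sum_univ_three, Matrix.map_apply,
      Matrix.transpose_apply, Matrix.vecHead, Matrix.vecTail, map_inv₀, S.unif_conj,
      inv_mul_cancel₀ S.unif_ne, mul_inv_cancel₀ S.unif_ne]

/-- The element `α = diag(ϖ⁻¹, 1, ϖ)` of `G`. -/
def alphaE : S.GG := ⟨S.alphaU, S.alphaU_mem⟩

lemma beta_mul_beta : S.betaM * S.betaM = 1 := by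
  ext i j
  fin_cases i <;> fin_cases j <;>
    simp [betaM, Matrix.mul_apply, Fin.sum_univ_three, Matrix.one_apply,
      Matrix.vecHead, Matrix.vecTail]

def betaU : Matrix.GeneralLinearGroup (Fin 3) S.E :=
  ⟨S.betaM, S.betaM, S.beta_mul_beta, S.beta_mul_beta⟩

lemma betaU_mem : S.betaU ∈ S.Gsub := by
  show ((S.betaU : S.M3)).transpose * S.betaM * ((S.betaU : S.M3).map S.conj) = S.betaM
  have : (S.betaU : S.M3) = S.betaM := rfl
  rw [this]
  ext i j
  fin_cases i <;> fin_cases j <;>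
    simp [betaM, Matrix.mul_apply, Fin.sum_univ_three, Matrix.map_apply, Matrix.transpose_apply,
      Matrix.vecHead, Matrix.vecTail]

/-- The element `β` of `G`. -/
def betaE : S.GG := ⟨S.betaU, S.betaU_mem⟩

/-- The element `β' = β * α⁻¹` of `G`. -/
def betaPr : S.GG := S.betaE * S.alphaE⁻¹

/-- A finite set `U` is a set of representatives for the cosets `A/B`. -/
def IsReps (A B : Set S.GG) (U : Finset S.GG) : Prop :=
  (↑U : Set S.GG) ⊆ A ∧ ∀ a ∈ A, ∃! u, u ∈ U ∧ a⁻¹ * u ∈ B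

/-- The residue field `k_E` of `E`. -/
abbrev kE := S.O ⧸ S.mI

/-- The residue map `o_E → k_E`. -/
def resmap : S.O →+* S.kE := Ideal.Quotient.mk S.mI

/-- The group `L_{q³} = {(x,t) ∈ k_E² : x x̄ + t + t̄ = 0}` (where `x̄ = x^q`). -/
def Lbig : Set (S.kE × S.kE) := {z | z.1 * z.1 ^ S.q + z.2 + z.2 ^ S.q = 0}

/-- The group `L_q = {(0,t) ∈ k_E² : t + t̄ = 0}`. -/
def Lsmall : Set (S.kE × S.kE) := {z | z.1 = 0 ∧ z.2 + z.2 ^ S.q = 0}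

/-- `L_{q^t}` for `t ∈ {1,3}`. -/
def Lof (t : ℕ) : Set (S.kE × S.kE) := if t = 3 then S.Lbig else S.Lsmall

end Setting

/-- A choice of one of the two maximal compact open subgroups `K ∈ {K₀, K₁}` of `G`,
together with its maximal normal pro-p subgroup `K¹`, the (pro-p) Iwahori subgroups
`I_K ⊇ I_{1,K}`, the opposite pro-p Iwahori `I'_{1,K}`, the element
`β_K ∈ K ∩ {β, β'}`, and the integers `n_K, m_K, t_K`. -/
structure Chamber (S : Setting) where
  K : Subgroup S.GG
  KoneS : Set S.GG
  IK : Set S.GG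
  I1 : Set S.GG
  I1' : Set S.GG
  βK : S.GG
  nK : ℤ
  mK : ℤ
  tK : ℕ
  cases :
    ((K : Set S.GG) = S.K0set ∧ KoneS = S.Kone0 ∧ IK = S.IK0 ∧ I1 = S.I1K0 ∧ I1' = S.I1'K0 ∧
      βK = S.betaE ∧ nK = 0 ∧ mK = 1 ∧ tK = 3) ∨
    ((K : Set S.GG) = S.K1set ∧ KoneS = S.Kone1 ∧ IK = S.IK1 ∧ I1 = S.I1K1 ∧ I1' = S.I1'K1 ∧
      βK = S.betaPr ∧ nK = -1 ∧ mK = 2 ∧ tK = 1)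

namespace Chamber

variable {S : Setting} (C : Chamber S)

/-- `H₀ = H ∩ I_K`. -/
def H0 : Set S.GG := S.Hset ∩ C.IK

/-- `H₁ = H ∩ I_{1,K}`. -/
def H1 : Set S.GG := S.Hset ∩ C.I1

end Chamber

section RepTheory

variable {S : Setting} (C : Chamber S)
variable (𝔽 : Type) [Field 𝔽]

section Generic

variable {G₀ : Type} [Monoid G₀] {V : Type} [AddCommGroup V] [Module 𝔽 V]

/-- A submodule is invariant under a representation. -/
def Invt (ρ : Representation 𝔽 G₀ V) (Ssub : Submodule 𝔽 V) : Prop :=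
  ∀ g v, v ∈ Ssub → ρ g v ∈ Ssub

/-- The subrepresentation generated by a vector (the span of its orbit). -/
def orbitSpan (ρ : Representation 𝔽 G₀ V) (v : V) : Submodule 𝔽 V :=
  Submodule.span 𝔽 {w | ∃ g, w = ρ g v}

/-- The subrepresentation generated by a vector under a subset `A` of the group. -/
def orbitSpanOn (ρ : Representation 𝔽 G₀ V) (A : Set G₀) (v : V) : Submodule 𝔽 V :=
  Submodule.span 𝔽 {w | ∃ g ∈ A, w = ρ g v}

/-- The quotient of a representation by an invariant submodule `N` is irreducible:
equivalently (by the lattice correspondence), `N ≠ ⊤` and any invariant submodule lying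
between `N` and `⊤` equals `N` or `⊤`. -/
def QuotientIrreducible (ρ : Representation 𝔽 G₀ V) (N : Submodule 𝔽 V) : Prop :=
  N ≠ ⊤ ∧ ∀ Ssub : Submodule 𝔽 V, Invt 𝔽 ρ Ssub → N ≤ Ssub → Ssub = N ∨ Ssub = ⊤

/-- The submodule of vectors invariant under all elements of the subset `A`. -/
def invariantsOn (ρ : Representation 𝔽 G₀ V) (A : Set G₀) : Submodule 𝔽 V where
  carrier := {v | ∀ g ∈ A, ρ g v = v}
  add_mem' := by
    intro a b ha hb g hg
    rw [map_add, ha g hg, hb g hg]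
  zero_mem' := by
    intro g hg
    rw [map_zero]
  smul_mem' := by
    intro c a ha g hg
    rw [map_smul, ha g hg]

/-- The space `Hom_G(ρ₁, ρ₂)` of equivariant linear maps, as a submodule of the linear maps. -/
def EquivHomSub {V₂ : Type} [AddCommGroup V₂] [Module 𝔽 V₂]
    (ρ₁ : Representation 𝔽 G₀ V) (ρ₂ : Representation 𝔽 G₀ V₂) :
    Submodule 𝔽 (V →ₗ[𝔽] V₂) where
  carrier := {φ | ∀ g x, φ (ρ₁ g x) = ρ₂ g (φ x)}
  add_mem' := by
    intro a b ha hb g x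
    simp only [LinearMap.add_apply, ha g x, hb g x, map_add]
  zero_mem' := by
    intro g x
    simp only [LinearMap.zero_apply, map_zero]
  smul_mem' := by
    intro c a ha g x
    simp only [LinearMap.smul_apply, ha g x, map_smul]

end Generic

section Weight

variable (W : Type) [AddCommGroup W] [Module 𝔽 W]
variable (σ : Representation 𝔽 ↥C.K W)

/-- Extension of `σ` to all of `G` (by `1` outside `K`); used to avoid coercion issues. -/
def sigma' : S.GG → Module.End 𝔽 W := fun g => if h : g ∈ C.K then σ ⟨g, h⟩ else 1

/-- `σ` is a weight of `K`: an irreducible smooth representation of `K` over `𝔽`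
factoring through `Γ_K = K / K¹` (automatically finite dimensional). -/
def IsWeight : Prop :=
  Nontrivial W ∧ FiniteDimensional 𝔽 W ∧
  (∀ Ssub : Submodule 𝔽 W, (∀ (k : ↥C.K) (w : W), w ∈ Ssub → σ k w ∈ Ssub) → Ssub = ⊥ ∨ Ssub = ⊤) ∧
  (∀ (g : S.GG) (hg : g ∈ C.K), g ∈ C.KoneS → σ ⟨g, hg⟩ = LinearMap.id)

/-- `σ` is one dimensional of the form `χ ∘ det`. -/
def IsDetWeight : Prop :=
  Module.finrank 𝔽 W = 1 ∧
  ∃ c : S.E → 𝔽, ∀ (g : S.GG) (hg : g ∈ C.K) (w : W), σ ⟨g, hg⟩ w = c ((S.mat g).det) • w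

/-- `j_σ : σ → σ` is the composition of the coinvariant projection `σ → σ_{I'_{1,K}}`
with the inverse of the natural isomorphism `σ^{I_{1,K}} ≅ σ_{I'_{1,K}}`:
it restricts to the identity on `σ^{I_{1,K}}` and kills the augmentation part of
`σ` with respect to `I'_{1,K}`. -/
def IsJ (jσ : W →ₗ[𝔽] W) : Prop :=
  (∀ w : W, (∀ g ∈ C.I1, sigma' C 𝔽 W σ g w = w) → jσ w = w) ∧
  (∀ (w : W) (g : S.GG), g ∈ C.I1' → jσ (sigma' C 𝔽 W σ g w - w) = 0)

/-- The defining conditions of the compact induction `ind_K^G σ`: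
`K`-equivariance on the left and compact support (finitely many cosets `K g`). -/
def IndCarrier : Set (S.GG → W) :=
  {f | (∀ (k : S.GG) (hk : k ∈ C.K) (g : S.GG), f (k * g) = σ ⟨k, hk⟩ (f g)) ∧
       ∃ s : Finset S.GG, ∀ g : S.GG, f g ≠ 0 → ∃ k ∈ C.K, ∃ t ∈ s, g = k * t}

/-- The compact induction `ind_K^G σ`, as a submodule of `G → W`. -/
def IndSub : Submodule 𝔽 (S.GG → W) where
  carrier := IndCarrier C 𝔽 W σ
  add_mem' := by
    rintro f g ⟨hf1, sf, hf2⟩ ⟨hg1, sg, hg2⟩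
    refine ⟨fun k hk x => by simp [hf1 k hk x, hg1 k hk x], sf ∪ sg, fun x hx => ?_⟩
    by_cases h : f x ≠ 0
    · obtain ⟨k, hk, t, ht, rfl⟩ := hf2 x h
      exact ⟨k, hk, t, Finset.mem_union_left _ ht, rfl⟩
    · push_neg at h
      have hgx : g x ≠ 0 := by
        intro h0
        apply hx
        simp [Pi.add_apply, h, h0]
      obtain ⟨k, hk, t, ht, rfl⟩ := hg2 x hgx
      exact ⟨k, hk, t, Finset.mem_union_right _ ht, rfl⟩
  zero_mem' := ⟨fun k hk g => by simp, ∅, fun g hg => absurd rfl hg⟩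
  smul_mem' := by
    rintro c f ⟨hf1, sf, hf2⟩
    refine ⟨fun k hk g => by simp [hf1 k hk g], sf, fun x hx => ?_⟩
    refine hf2 x ?_
    intro h0
    apply hx
    simp [h0]

lemma indAct_mem (g : S.GG) {f : S.GG → W} (hf : f ∈ IndCarrier C 𝔽 W σ) :
    (fun x => f (x * g)) ∈ IndCarrier C 𝔽 W σ := by
  obtain ⟨h1, s, h2⟩ := hf
  refine ⟨fun k hk x => ?_, s.image (· * g⁻¹), ?_⟩
  · show f (k * x * g) = _
    rw [mul_assoc]
    exact h1 k hk (x * g)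
  intro x hx
  obtain ⟨k, hk, t, ht, hxg⟩ := h2 (x * g) hx
  refine ⟨k, hk, t * g⁻¹, Finset.mem_image_of_mem _ ht, ?_⟩
  rw [← mul_assoc, ← hxg, mul_assoc, mul_inv_cancel, mul_one]

/-- The representation of `G` on `ind_K^G σ` by right translation. -/
def indRep : Representation 𝔽 S.GG ↥(IndSub C 𝔽 W σ) where
  toFun g :=
    { toFun := fun f => ⟨fun x => (f : S.GG → W) (x * g), indAct_mem C 𝔽 W σ g f.2⟩
      map_add' := fun f1 f2 => Subtype.ext (funext fun x => rfl)
      map_smul' := fun c f => Subtype.ext (funext fun x => rfl) }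
  map_one' := LinearMap.ext fun f => Subtype.ext (funext fun x => by simp [mul_one])
  map_mul' g h := LinearMap.ext fun f => Subtype.ext (funext fun x => by simp [mul_assoc])

/-- The function `[g, v] ∈ ind_K^G σ`: supported on `K g⁻¹`, with value `v` at `g⁻¹`. -/
def stdFn (g : S.GG) (v : W) : S.GG → W :=
  fun x => if h : x * g ∈ C.K then σ ⟨x * g, h⟩ v else 0

/-- The characterization of the family `f_n` (`n ∈ ℤ`) of `I_{1,K}`-invariant elements of
`ind_K^G σ`: `f_n` is supported on `K α⁻ⁿ I_{1,K}` and has value at `α⁻ⁿ` equal to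
`σ(β_K) v₀` for `n > 0` and `v₀` for `n ≤ 0`, where `v₀` is a fixed nonzero vector of
`σ^{I_{1,K}}`. -/
def IsFFamily (v0 : W) (ff : ℤ → ↥(IndSub C 𝔽 W σ)) : Prop :=
  v0 ≠ 0 ∧ (∀ g ∈ C.I1, sigma' C 𝔽 W σ g v0 = v0) ∧
  (∀ (n : ℤ) (g : S.GG), g ∈ C.I1 → indRep C 𝔽 W σ g (ff n) = ff n) ∧
  (∀ (n : ℤ) (x : S.GG), (ff n : S.GG → W) x ≠ 0 →
    ∃ k ∈ C.K, ∃ i ∈ C.I1, x = k * S.alphaE ^ (-n) * i) ∧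
  (∀ n : ℤ, 0 < n → (ff n : S.GG → W) (S.alphaE ^ (-n)) = sigma' C 𝔽 W σ C.βK v0) ∧
  (∀ n : ℤ, n ≤ 0 → (ff n : S.GG → W) (S.alphaE ^ (-n)) = v0)

/-- The characterization of the Hecke operator `T ∈ End_G(ind_K^G σ)`:
it is `G`-equivariant and satisfies
`T [1, v] = ∑_{u ∈ N_{n_K}/N_{n_K+2}} [u α⁻¹, j_σ σ(u⁻¹) v]
  + ∑_{u ∈ N_{n_K+1}/N_{n_K+2}} [β_K u α⁻¹, j_σ σ(β_K) v]`. -/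
def IsHeckeT (jσ : W →ₗ[𝔽] W) (T : Module.End 𝔽 ↥(IndSub C 𝔽 W σ)) : Prop :=
  (∀ (g : S.GG) (x : ↥(IndSub C 𝔽 W σ)),
    T (indRep C 𝔽 W σ g x) = indRep C 𝔽 W σ g (T x)) ∧
  (∀ (v : W) (x : ↥(IndSub C 𝔽 W σ)), (x : S.GG → W) = stdFn C 𝔽 W σ 1 v →
    ∀ (U2 U1 : Finset S.GG),
      S.IsReps (S.Nk C.nK) (S.Nk (C.nK + 2)) U2 →
      S.IsReps (S.Nk (C.nK + 1)) (S.Nk (C.nK + 2)) U1 →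
      ((T x : S.GG → W)) =
        (∑ u ∈ U2, stdFn C 𝔽 W σ (u * S.alphaE⁻¹) (jσ (sigma' C 𝔽 W σ u⁻¹ v))) +
        ∑ u ∈ U1, stdFn C 𝔽 W σ (C.βK * u * S.alphaE⁻¹) (jσ (sigma' C 𝔽 W σ C.βK v)))

/-- The eigencharacter `χ_σ` of `H₀/H₁` afforded by the (one-dimensional) space
`σ^{I_{1,K}}` with chosen basis vector `v₀`. -/
def IsChi (v0 : W) (χ : S.GG → 𝔽) : Prop :=
  (∀ h ∈ C.H0, sigma' C 𝔽 W σ h v0 = χ h • v0)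

/-- Right translation on functions `K → 𝔽` (the action on a (finite) principal series). -/
def PSact (k : ↥C.K) (f : ↥C.K → 𝔽) : ↥C.K → 𝔽 := fun x => f (x * k)

/-- The (inflation to `K` of the) finite principal series `Ind_𝔹^{Γ_K} χ`:
functions on `K`, invariant under right translation by `K¹`, left `I_{1,K}`-invariant and
left `(H₀, χ)`-equivariant. -/
def PSchiSub (χ : S.GG → 𝔽) : Submodule 𝔽 (↥C.K → 𝔽) where
  carrier := {f | (∀ b : ↥C.K, (b : S.GG) ∈ C.I1 → ∀ x, f (b * x) = f x) ∧
                  (∀ h : ↥C.K, (h : S.GG) ∈ C.H0 → ∀ x, f (h * x) = χ (h : S.GG) * f x) ∧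
                  (∀ z : ↥C.K, (z : S.GG) ∈ C.KoneS → ∀ x, f (x * z) = f x)}
  add_mem' := by
    rintro f g ⟨hf1, hf2, hf3⟩ ⟨hg1, hg2, hg3⟩
    exact ⟨fun b hb x => by simp [hf1 b hb x, hg1 b hb x],
           fun h hh x => by simp [hf2 h hh x, hg2 h hh x, mul_add],
           fun z hz x => by simp [hf3 z hz x, hg3 z hz x]⟩
  zero_mem' := ⟨fun b hb x => rfl, fun h hh x => by simp, fun z hz x => rfl⟩
  smul_mem' := by
    rintro c f ⟨hf1, hf2, hf3⟩
    refine ⟨fun b hb x => by simp [hf1 b hb x], fun h hh x => ?_, fun z hz x => by simp [hf3 z hz x]⟩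
    simp only [Pi.smul_apply, hf2 h hh x, smul_eq_mul]
    ring

/-- The principal series `Ind_𝔹^{Γ_K} 1` for the trivial character. -/
def PS1sub : Submodule 𝔽 (↥C.K → 𝔽) := PSchiSub C 𝔽 (fun _ => 1)

/-- `σ_{st}` is the Steinberg weight `st = (Ind_𝔹^{Γ_K} 1)/1`: there is a surjective
`K`-equivariant linear map from `Ind_𝔹^{Γ_K} 1` to it whose kernel is exactly the
constant functions. -/
def IsSteinberg {Wst : Type} [AddCommGroup Wst] [Module 𝔽 Wst]
    (σst : Representation 𝔽 ↥C.K Wst) : Prop :=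
  ∃ φ : ↥(PS1sub C 𝔽) →ₗ[𝔽] Wst, Function.Surjective φ ∧
    (∀ f : ↥(PS1sub C 𝔽), φ f = 0 ↔ ∃ c : 𝔽, (f : ↥C.K → 𝔽) = fun _ => c) ∧
    (∀ (k : ↥C.K) (f f' : ↥(PS1sub C 𝔽)),
      (f' : ↥C.K → 𝔽) = PSact C 𝔽 k (f : ↥C.K → 𝔽) → φ f' = σst k (φ f))

/-- `σ` is isomorphic to a twist of the Steinberg weight by a character. -/
def IsTwistSteinberg : Prop :=
  ∃ (c : ↥C.K →* 𝔽ˣ) (φ : ↥(PS1sub C 𝔽) →ₗ[𝔽] W), Function.Surjective φ ∧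
    (∀ f : ↥(PS1sub C 𝔽), φ f = 0 ↔ ∃ cc : 𝔽, (f : ↥C.K → 𝔽) = fun _ => cc) ∧
    (∀ (k : ↥C.K) (f f' : ↥(PS1sub C 𝔽)),
      (f' : ↥C.K → 𝔽) = PSact C 𝔽 k (f : ↥C.K → 𝔽) →
        φ f' = (c k : 𝔽) • σ k (φ f))


/-- The `K`-subrepresentation of the quotient `(ind_K^G σ) / (range T)` generated by the
image of a vector `v`. -/
def genQuot (T : Module.End 𝔽 ↥(IndSub C 𝔽 W σ)) (v : ↥(IndSub C 𝔽 W σ)) :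
    Submodule 𝔽 (↥(IndSub C 𝔽 W σ) ⧸ LinearMap.range T) :=
  Submodule.span 𝔽 {w | ∃ k ∈ C.K, w = Submodule.Quotient.mk (indRep C 𝔽 W σ k v)}

end Weight

/-- Smoothness of a representation of `G`: every vector is fixed by some congruence
subgroup (equivalently, has open stabilizer). -/
def SmoothRep {V : Type} [AddCommGroup V] [Module 𝔽 V] (ρ : Representation 𝔽 S.GG V) : Prop :=
  ∀ v : V, ∃ n : ℕ, ∀ g ∈ S.cong n, ρ g v = v

end RepTheory

end U21


namespace U21

namespace Setting

variable (S : Setting)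

/-! ### The valuation of `E` -/

lemma conj_inj {x : S.E} : S.conj x = 0 ↔ x = 0 :=
  map_eq_zero_iff _ S.conj.injective

lemma unif_inv_notMem : S.ϖ⁻¹ ∉ S.O := fun h =>
  S.unif_not_unit (IsUnit.of_mul_eq_one ⟨S.ϖ⁻¹, h⟩ (Subtype.ext (mul_inv_cancel₀ S.unif_ne)))

lemma unif_zpow_mem {k : ℤ} : S.ϖ ^ k ∈ S.O ↔ 0 ≤ k := by
  constructor
  · intro h
    by_contra! hk
    obtain ⟨m, rfl⟩ : ∃ m : ℕ, k = -((m : ℤ) + 1) := ⟨(-k - 1).toNat, by omega⟩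
    apply S.unif_inv_notMem
    have := S.O.mul_mem h (S.O.pow_mem S.unif_mem m)
    rwa [← zpow_natCast, ← zpow_add₀ S.unif_ne, show -((m : ℤ) + 1) + m = -1 by ring,
      zpow_neg_one] at this
  · intro h
    lift k to ℕ using h
    rw [zpow_natCast]
    exact S.O.pow_mem S.unif_mem k

/-- The normalized valuation of a nonzero element of `E` (with junk value at `0`). -/
def val (x : S.E) : ℤ := if h : x ≠ 0 then (S.disc x h).choose else 0

lemma exists_unit_mul {x : S.E} (h : x ≠ 0) : ∃ u : S.Oˣ, x = (u : S.O) * S.ϖ ^ S.val x := by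
  have := (S.disc x h).choose_spec
  rwa [val, dif_pos h]

lemma unit_ne (u : S.Oˣ) : ((u : S.O) : S.E) ≠ 0 := by
  intro h
  exact u.ne_zero (Subtype.ext h)

lemma unit_inv_mem (u : S.Oˣ) : (((u : S.O) : S.E))⁻¹ ∈ S.O := by
  have h : ((u : S.O) : S.E) * ((u⁻¹ : S.Oˣ) : S.O) = 1 := by
    rw [← Subring.coe_mul, Units.mul_inv, Subring.coe_one]
  rw [inv_eq_of_mul_eq_one_right h]
  exact Subtype.mem _

lemma mem_pE {x : S.E} {k : ℤ} : x ∈ S.pE k ↔ x = 0 ∨ k ≤ S.val x := by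
  by_cases h : x = 0
  · simp only [h, true_or, iff_true]
    exact ⟨0, S.O.zero_mem, by simp⟩
  obtain ⟨u, hu⟩ := S.exists_unit_mul h
  simp only [h, false_or]
  constructor
  · rintro ⟨w, hw, hx⟩
    have : S.ϖ ^ (S.val x - k) ∈ S.O := by
      have e : S.ϖ ^ (S.val x - k) = ((u : S.O) : S.E)⁻¹ * w := by
        rw [zpow_sub₀ S.unif_ne, eq_inv_mul_iff_mul_eq₀ (S.unit_ne u), ← mul_div_assoc, ← hu, hx,
          mul_div_cancel_left₀ _ (zpow_ne_zero _ S.unif_ne)]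
      rw [e]
      exact S.O.mul_mem (S.unit_inv_mem u) hw
    have := S.unif_zpow_mem.1 this
    omega
  · intro hk
    refine ⟨(u : S.O) * S.ϖ ^ (S.val x - k),
      S.O.mul_mem (Subtype.mem _) (S.unif_zpow_mem.2 (by omega)), ?_⟩
    rw [mul_left_comm, ← zpow_add₀ S.unif_ne, add_sub_cancel, ← hu]

lemma pE_zero_iff {x : S.E} : x ∈ S.pE 0 ↔ x ∈ S.O := by
  simp [pE]

lemma val_unique {x : S.E} {k : ℤ} (h : ∀ j, x ∈ S.pE j ↔ j ≤ k) : S.val x = k := by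
  have h0 : x ≠ 0 := by
    rintro rfl
    have := (h (k + 1)).1 (S.mem_pE.2 (Or.inl rfl))
    omega
  have h1 := (h k).2 le_rfl
  have h2 := (h (S.val x)).1 (S.mem_pE.2 (Or.inr le_rfl))
  rw [S.mem_pE] at h1
  rcases h1 with h1 | h1
  · exact absurd h1 h0
  · omega

lemma val_unit_mul (u : S.Oˣ) (k : ℤ) : S.val ((u : S.O) * S.ϖ ^ k) = k := by
  apply S.val_unique
  intro j
  constructor
  · rintro ⟨w, hw, hx⟩
    have : S.ϖ ^ (k - j) ∈ S.O := by
      have e : S.ϖ ^ (k - j) = ((u : S.O) : S.E)⁻¹ * w := by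
        rw [zpow_sub₀ S.unif_ne, eq_inv_mul_iff_mul_eq₀ (S.unit_ne u), ← mul_div_assoc, hx,
          mul_div_cancel_left₀ _ (zpow_ne_zero _ S.unif_ne)]
      rw [e]
      exact S.O.mul_mem (S.unit_inv_mem u) hw
    have := S.unif_zpow_mem.1 this
    omega
  · intro hk
    refine ⟨(u : S.O) * S.ϖ ^ (k - j),
      S.O.mul_mem (Subtype.mem _) (S.unif_zpow_mem.2 (by omega)), ?_⟩
    rw [mul_left_comm, ← zpow_add₀ S.unif_ne, add_sub_cancel]

lemma val_mul {x y : S.E} (hx : x ≠ 0) (hy : y ≠ 0) : S.val (x * y) = S.val x + S.val y := by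
  obtain ⟨u, hu⟩ := S.exists_unit_mul hx
  obtain ⟨v, hv⟩ := S.exists_unit_mul hy
  have e : x * y = ((u * v : S.Oˣ) : S.O) * S.ϖ ^ (S.val x + S.val y) := by
    rw [zpow_add₀ S.unif_ne, Units.val_mul, Subring.coe_mul]
    nth_rewrite 1 [hu, hv]
    ring
  rw [e, val_unit_mul]

lemma val_zpow_unif (k : ℤ) : S.val (S.ϖ ^ k) = k := by
  simpa using S.val_unit_mul 1 k

lemma val_unif : S.val S.ϖ = 1 := by
  simpa using S.val_zpow_unif 1

lemma val_one : S.val 1 = 0 := by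
  simpa using S.val_zpow_unif 0

lemma val_inv {x : S.E} : S.val x⁻¹ = - S.val x := by
  by_cases h : x = 0
  · simp [h, val]
  have := S.val_mul h (inv_ne_zero h)
  rw [mul_inv_cancel₀ h, val_one] at this
  omega

lemma pE_conj {x : S.E} {k : ℤ} (h : x ∈ S.pE k) : S.conj x ∈ S.pE k := by
  obtain ⟨w, hw, rfl⟩ := h
  exact ⟨S.conj w, S.conj_O w hw, by rw [map_mul, map_zpow₀, S.unif_conj]⟩

lemma val_conj (x : S.E) : S.val (S.conj x) = S.val x := by
  by_cases h : x = 0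
  · simp [h]
  symm
  apply S.val_unique
  intro j
  have h1 : S.conj x ≠ 0 := fun h0 => h (S.conj_inj.1 h0)
  constructor
  · intro hj
    have := S.mem_pE.1 (S.pE_conj hj)
    tauto
  · intro hj
    have := S.pE_conj (S.mem_pE.2 (Or.inr hj))
    rwa [S.conj_invol] at this

variable {S}

lemma pE_zero_mem (k : ℤ) : (0 : S.E) ∈ S.pE k := S.mem_pE.2 (Or.inl rfl)

lemma pE_mono {x : S.E} {j k : ℤ} (h : x ∈ S.pE k) (hjk : j ≤ k) : x ∈ S.pE j := by
  rw [mem_pE] at h ⊢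
  exact h.imp_right hjk.trans

lemma pE_add {x y : S.E} {k : ℤ} (hx : x ∈ S.pE k) (hy : y ∈ S.pE k) : x + y ∈ S.pE k := by
  obtain ⟨a, ha, rfl⟩ := hx
  obtain ⟨b, hb, rfl⟩ := hy
  exact ⟨a + b, S.O.add_mem ha hb, by ring⟩

lemma pE_neg {x : S.E} {k : ℤ} (hx : x ∈ S.pE k) : -x ∈ S.pE k := by
  obtain ⟨a, ha, rfl⟩ := hx
  exact ⟨-a, S.O.neg_mem ha, by ring⟩

lemma pE_sub {x y : S.E} {k : ℤ} (hx : x ∈ S.pE k) (hy : y ∈ S.pE k) : x - y ∈ S.pE k := by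
  rw [sub_eq_add_neg]
  exact pE_add hx (pE_neg hy)

lemma pE_mul {x y : S.E} {j k l : ℤ} (hx : x ∈ S.pE j) (hy : y ∈ S.pE k) (h : l ≤ j + k) :
    x * y ∈ S.pE l := by
  obtain ⟨a, ha, rfl⟩ := hx
  obtain ⟨b, hb, rfl⟩ := hy
  refine pE_mono ⟨a * b, S.O.mul_mem ha hb, ?_⟩ h
  rw [zpow_add₀ S.unif_ne]
  ring

lemma zpow_mem_pE (k : ℤ) : S.ϖ ^ k ∈ S.pE k := ⟨1, S.O.one_mem, by simp⟩

lemma unif_mem_pE : S.ϖ ∈ S.pE 1 := ⟨1, S.O.one_mem, by simp⟩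

lemma unif_inv_mem_pE : S.ϖ⁻¹ ∈ S.pE (-1) := ⟨1, S.O.one_mem, by simp⟩

lemma one_mem_pE : (1 : S.E) ∈ S.pE 0 := S.pE_zero_iff.2 S.O.one_mem

lemma one_notMem_pE {k : ℤ} (hk : 0 < k) : (1 : S.E) ∉ S.pE k := by
  rw [mem_pE, val_one]
  simp [hk]

/-- If `x x̄ + y + ȳ = 0` and `y ∈ p_E ^ k`, then `x ∈ p_E ^ ⌈k / 2⌉`. -/
lemma mem_pE_of_isotropic {x y : S.E} {j k : ℤ} (h : x * S.conj x + y + S.conj y = 0)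
    (hy : y ∈ S.pE k) (hj : 2 * j ≤ k + 1) : x ∈ S.pE j := by
  by_cases hx : x = 0
  · exact hx ▸ pE_zero_mem j
  have h1 : x * S.conj x ∈ S.pE k := by
    rw [show x * S.conj x = -(y + S.conj y) by linear_combination h]
    exact pE_neg (pE_add hy (S.pE_conj hy))
  have hc : S.conj x ≠ 0 := fun h0 => hx (S.conj_inj.1 h0)
  rw [mem_pE, S.val_mul hx hc, S.val_conj] at h1
  rcases h1 with h1 | h1
  · exact absurd h1 (mul_ne_zero hx hc)
  · rw [mem_pE]
    omega

variable (S) in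
lemma exists_trace_zero (k : ℤ) : ∃ d : S.E, d ≠ 0 ∧ S.val d = k ∧ d + S.conj d = 0 := by
  obtain ⟨e, he⟩ : ∃ e, S.conj e ≠ e := by
    by_contra! h
    exact S.conj_ne (RingHom.ext h)
  have h0 : e - S.conj e ≠ 0 := fun h => he (sub_eq_zero.1 h).symm
  have hz : ∀ j : ℤ, S.ϖ ^ j ≠ 0 := fun j => zpow_ne_zero _ S.unif_ne
  refine ⟨(e - S.conj e) * S.ϖ ^ (k - S.val (e - S.conj e)), mul_ne_zero h0 (hz _), ?_, ?_⟩
  · rw [S.val_mul h0 (hz _), S.val_zpow_unif]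
    ring
  · rw [map_mul, map_zpow₀, S.unif_conj, map_sub, S.conj_invol]
    ring

variable (S) in
lemma natCast_p_mem : (S.p : S.E) ∈ S.pE 1 := by
  by_cases h0 : (S.p : S.E) = 0
  · rw [h0]
    exact pE_zero_mem 1
  have hq : ((S.q ^ 2 : ℕ) : S.O) ∈ S.mI := by
    rw [← Ideal.Quotient.eq_zero_iff_mem, map_natCast, ← S.card_res]
    exact Nat.cast_card_eq_zero _
  obtain ⟨y, hy, e⟩ := (S.hmI _).1 hq
  have h1 : (S.p : S.E) ^ (S.fdeg * 2) ∈ S.pE 1 := by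
    refine ⟨y, hy, ?_⟩
    rw [zpow_one, ← e, S.hq, ← pow_mul]
    simp
  have h2 : ∀ m : ℕ, S.val ((S.p : S.E) ^ m) = m * S.val (S.p : S.E) := by
    intro m
    induction m with
    | zero => simp [S.val_one]
    | succ m ih =>
      rw [pow_succ, S.val_mul (pow_ne_zero _ h0) h0, ih]
      push_cast
      ring
  rw [mem_pE, h2] at h1
  rw [mem_pE]
  right
  rcases h1 with h1 | h1
  · exact absurd h1 (pow_ne_zero _ h0)
  · by_contra! h
    have : ((S.fdeg * 2 : ℕ) : ℤ) * S.val (S.p : S.E) ≤ 0 :=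
      mul_nonpos_of_nonneg_of_nonpos (by positivity) (by omega)
    omega

end Setting

end U21

namespace U21

namespace Setting

/-! ### Elements of `G` and their matrices -/

section Matrices

variable (S : Setting)

/-- The adjoint `β * conj(M)ᵀ * β` of `M` with respect to the Hermitian form, entrywise. -/
def adj (M : S.M3) : S.M3 := Matrix.of fun i j => S.conj (M j.rev i.rev)

lemma adj_eq (M : S.M3) : S.adj M = S.betaM * (M.map S.conj).transpose * S.betaM := by
  ext i j
  fin_cases i <;> fin_cases j <;>
    simp [adj, betaM, Matrix.mul_apply, Matrix.vecMul, dotProduct, Fin.sum_univ_three, Fin.rev]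

lemma adj_mul_of_isometry {M : S.M3}
    (h : M.transpose * S.betaM * M.map S.conj = S.betaM) : S.adj M * M = 1 := by
  have h1 := congrArg (fun A : S.M3 => (A.map S.conj)) h
  have h2 : S.betaM.map S.conj = S.betaM := by
    ext i j
    fin_cases i <;> fin_cases j <;> simp [betaM]
  have h3 : (M.map S.conj).map S.conj = M := by
    ext i j
    simp [S.conj_invol]
  simp only [Matrix.map_mul, h2, h3] at h1
  rw [adj_eq]
  calc S.betaM * (M.map S.conj).transpose * S.betaM * M
      = S.betaM * ((M.map S.conj).transpose * S.betaM * M) := by simp only [mul_assoc]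
    _ = 1 := by
      rw [← Matrix.transpose_map, h1, S.beta_mul_beta]

/-- The element of `G` attached to an isometry matrix. -/
def ofMat (M : S.M3) (h : M.transpose * S.betaM * M.map S.conj = S.betaM) : S.GG :=
  ⟨⟨M, S.adj M, mul_eq_one_comm.1 (S.adj_mul_of_isometry h), S.adj_mul_of_isometry h⟩, h⟩

variable {S}

@[simp] lemma mat_ofMat (M : S.M3) (h) : S.mat (S.ofMat M h) = M := rfl

lemma mat_ext {g h : S.GG} (e : S.mat g = S.mat h) : g = h :=
  Subtype.ext (Units.ext e)

lemma mat_mul (g h : S.GG) : S.mat (g * h) = S.mat g * S.mat h := rfl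

lemma mat_one : S.mat 1 = 1 := rfl

lemma mat_mul_apply (g h : S.GG) (i j : Fin 3) : S.mat (g * h) i j =
    S.mat g i 0 * S.mat h 0 j + S.mat g i 1 * S.mat h 1 j + S.mat g i 2 * S.mat h 2 j := by
  rw [mat_mul, Matrix.mul_apply, Fin.sum_univ_three]

lemma mat_inv (g : S.GG) : S.mat g⁻¹ = S.adj (S.mat g) := by
  have h1 : S.mat g⁻¹ * S.mat g = 1 := by rw [← mat_mul, inv_mul_cancel, mat_one]
  have h2 : S.mat g * S.mat g⁻¹ = 1 := by rw [← mat_mul, mul_inv_cancel, mat_one]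
  have h3 := S.adj_mul_of_isometry g.2
  calc S.mat g⁻¹ = S.adj (S.mat g) * S.mat g * S.mat g⁻¹ := by
        rw [show S.adj (S.mat g) * S.mat g = 1 from h3, one_mul]
    _ = S.adj (S.mat g) := by rw [mul_assoc, h2, mul_one]

lemma mat_inv_apply (g : S.GG) (i j : Fin 3) :
    S.mat g⁻¹ i j = S.conj (S.mat g j.rev i.rev) := by
  rw [mat_inv]
  rfl

lemma mat_alpha : S.mat S.alphaE = S.alphaM := rfl

lemma mat_alpha_inv : S.mat S.alphaE⁻¹ = S.alphaMinv := rfl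

/-- The bottom row of an element of `G` is isotropic. -/
lemma bottom_row_isotropic (g : S.GG) : S.mat g 2 0 * S.conj (S.mat g 2 2) +
    S.mat g 2 1 * S.conj (S.mat g 2 1) + S.mat g 2 2 * S.conj (S.mat g 2 0) = 0 := by
  have h : S.mat (g * g⁻¹) 2 0 = 0 := by
    rw [mul_inv_cancel, mat_one]
    simp
  rwa [mat_mul_apply, mat_inv_apply, mat_inv_apply, mat_inv_apply] at h

lemma nM_isometry {x y : S.E} (h : x * S.conj x + y + S.conj y = 0) :
    (S.nM x y).transpose * S.betaM * (S.nM x y).map S.conj = S.betaM := by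
  ext i j
  fin_cases i <;> fin_cases j <;>
    simp [nM, betaM, Matrix.mul_apply, Fin.sum_univ_three, S.conj_invol]
  linear_combination h

lemma n'M_isometry {x y : S.E} (h : x * S.conj x + y + S.conj y = 0) :
    (S.n'M x y).transpose * S.betaM * (S.n'M x y).map S.conj = S.betaM := by
  ext i j
  fin_cases i <;> fin_cases j <;>
    simp [n'M, betaM, Matrix.mul_apply, Fin.sum_univ_three, S.conj_invol]
  linear_combination h

/-- The element `n(x, y)` of `G`. -/
def nE (x y : S.E) (h : x * S.conj x + y + S.conj y = 0) : S.GG := S.ofMat _ (nM_isometry h)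

/-- The element `n'(x, y)` of `G`. -/
def n'E (x y : S.E) (h : x * S.conj x + y + S.conj y = 0) : S.GG := S.ofMat _ (n'M_isometry h)

lemma mat_nE (x y : S.E) (h) : S.mat (nE x y h) = S.nM x y := rfl

lemma mat_n'E (x y : S.E) (h) : S.mat (n'E x y h) = S.n'M x y := rfl

lemma nE_inv (x y : S.E) (h) :
    (nE x y h)⁻¹ = nE (-x) (S.conj y) (by rw [S.conj_invol, map_neg]; linear_combination h) := by
  apply mat_ext
  rw [mat_inv]
  ext i j
  fin_cases i <;> fin_cases j <;> simp [adj, mat_nE, nM, S.conj_invol, Fin.rev]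

lemma n'E_inv (x y : S.E) (h) :
    (n'E x y h)⁻¹ = n'E (-x) (S.conj y) (by rw [S.conj_invol, map_neg]; linear_combination h) := by
  apply mat_ext
  rw [mat_inv]
  ext i j
  fin_cases i <;> fin_cases j <;> simp [adj, mat_n'E, n'M, S.conj_invol, Fin.rev]

lemma nE_mul {x y x' y' : S.E} (h h') :
    nE x y h * nE x' y' h' = nE (x + x') (y + y' - x * S.conj x')
      (by simp only [map_add, map_sub, map_mul, S.conj_invol]; linear_combination h + h') := by
  apply mat_ext
  rw [mat_mul]
  ext i j
  fin_cases i <;> fin_cases j <;>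
    simp [mat_nE, nM, Matrix.mul_apply, Fin.sum_univ_three] <;> ring

end Matrices

/-! ### The subgroups `N_k`, `N'_k` and the Borel subgroup -/

section Subgroups

variable (S : Setting)

lemma mul_conj_mem_pE {x y x' y' : S.E} {k : ℤ} (h : x * S.conj x + y + S.conj y = 0)
    (h' : x' * S.conj x' + y' + S.conj y' = 0) (hy : y ∈ S.pE k) (hy' : y' ∈ S.pE k) :
    x * S.conj x' ∈ S.pE k :=
  pE_mul (mem_pE_of_isotropic h hy (j := (k + 1) / 2) (by omega))
    (S.pE_conj (mem_pE_of_isotropic h' hy' (j := (k + 1) / 2) (by omega))) (by omega)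

lemma nE_mem_Nk {k : ℤ} {x y : S.E} {h} (hy : y ∈ S.pE k) : nE x y h ∈ S.Nk k :=
  ⟨x, y, h, hy, rfl⟩

/-- `N_k` as a subgroup of `G`. -/
def NkSub (k : ℤ) : Subgroup S.GG where
  carrier := S.Nk k
  one_mem' := ⟨0, 0, by simp, pE_zero_mem k, by
    ext i j; fin_cases i <;> fin_cases j <;> simp [mat_one, nM]⟩
  mul_mem' := by
    rintro a b ⟨x, y, h, hy, ha⟩ ⟨x', y', h', hy', hb⟩
    rw [mat_ext (h := nE x y h) ha, mat_ext (h := nE x' y' h') hb, nE_mul]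
    exact S.nE_mem_Nk (pE_sub (pE_add hy hy') (S.mul_conj_mem_pE h h' hy hy'))
  inv_mem' := by
    rintro a ⟨x, y, h, hy, ha⟩
    rw [mat_ext (h := nE x y h) ha, nE_inv]
    exact S.nE_mem_Nk (S.pE_conj hy)

/-- The upper triangular Borel subgroup of `G`. -/
def Bsub : Subgroup S.GG where
  carrier := {g | S.mat g 1 0 = 0 ∧ S.mat g 2 0 = 0 ∧ S.mat g 2 1 = 0}
  one_mem' := by simp [mat_one]
  mul_mem' := by
    rintro a b ⟨h1, h2, h3⟩ ⟨h4, h5, h6⟩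
    simp [mat_mul_apply, h1, h2, h3, h4, h5, h6]
  inv_mem' := by
    rintro a ⟨h1, h2, h3⟩
    simp [mat_inv_apply, Fin.rev, h1, h2, h3]

variable {S}

lemma mem_Bsub {g : S.GG} :
    g ∈ S.Bsub ↔ S.mat g 1 0 = 0 ∧ S.mat g 2 0 = 0 ∧ S.mat g 2 1 = 0 := Iff.rfl

lemma mem_NkSub {k : ℤ} {g : S.GG} :
    g ∈ S.NkSub k ↔ ∃ x y h, y ∈ S.pE k ∧ g = nE x y h := by
  constructor
  · rintro ⟨x, y, h, hy, hg⟩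
    exact ⟨x, y, h, hy, mat_ext hg⟩
  · rintro ⟨x, y, h, hy, rfl⟩
    exact ⟨x, y, h, hy, rfl⟩

lemma mem_N'k {k : ℤ} {g : S.GG} :
    g ∈ S.N'k k ↔ ∃ x y h, y ∈ S.pE k ∧ g = n'E x y h := by
  constructor
  · rintro ⟨x, y, h, hy, hg⟩
    exact ⟨x, y, h, hy, mat_ext hg⟩
  · rintro ⟨x, y, h, hy, rfl⟩
    exact ⟨x, y, h, hy, rfl⟩

lemma nE_mem {k : ℤ} {x y : S.E} {h} : nE x y h ∈ S.NkSub k ↔ y ∈ S.pE k := by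
  constructor
  · rintro ⟨x', y', h', hy, hg⟩
    have := congrFun (congrFun hg 0) 2
    rw [mat_nE] at this
    simp only [nM, Matrix.of_apply, Matrix.cons_val] at this
    rwa [this]
  · intro hy
    exact mem_NkSub.2 ⟨x, y, h, hy, rfl⟩

lemma NkSub_le_Bsub (k : ℤ) : S.NkSub k ≤ S.Bsub := by
  intro g hg
  obtain ⟨x, y, h, -, rfl⟩ := mem_NkSub.1 hg
  simp [mem_Bsub, mat_nE, nM]

lemma NkSub_mono {j k : ℤ} (h : j ≤ k) : S.NkSub k ≤ S.NkSub j := by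
  intro g hg
  obtain ⟨x, y, e, hy, rfl⟩ := mem_NkSub.1 hg
  exact nE_mem.2 (pE_mono hy h)

lemma N'k_inv {k : ℤ} {g : S.GG} (hg : g ∈ S.N'k k) : g⁻¹ ∈ S.N'k k := by
  obtain ⟨x, y, e, hy, rfl⟩ := mem_N'k.1 hg
  rw [n'E_inv]
  exact mem_N'k.2 ⟨_, _, _, S.pE_conj hy, rfl⟩

lemma alpha_mem_Bsub : S.alphaE ∈ S.Bsub := by
  simp [mem_Bsub, mat_alpha, alphaM]

lemma alpha_conj_nE (x y : S.E) (h) : S.alphaE * nE x y h * S.alphaE⁻¹ =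
    nE (S.ϖ⁻¹ * x) (S.ϖ⁻¹ * S.ϖ⁻¹ * y) (by
      simp only [map_mul, map_inv₀, S.unif_conj]
      linear_combination S.ϖ⁻¹ * S.ϖ⁻¹ * h) := by
  apply mat_ext
  have := S.unif_ne
  rw [mat_mul, mat_mul, mat_alpha, mat_alpha_inv]
  ext i j
  fin_cases i <;> fin_cases j <;>
    simp [mat_nE, nM, alphaM, alphaMinv, Matrix.mul_apply, Fin.sum_univ_three, S.unif_conj] <;>
    field_simp

lemma alpha_conj_n'E (x y : S.E) (h) : S.alphaE⁻¹ * n'E x y h * S.alphaE =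
    n'E (S.ϖ⁻¹ * x) (S.ϖ⁻¹ * S.ϖ⁻¹ * y) (by
      simp only [map_mul, map_inv₀, S.unif_conj]
      linear_combination S.ϖ⁻¹ * S.ϖ⁻¹ * h) := by
  apply mat_ext
  have := S.unif_ne
  rw [mat_mul, mat_mul, mat_alpha, mat_alpha_inv]
  ext i j
  fin_cases i <;> fin_cases j <;>
    simp [mat_n'E, n'M, alphaM, alphaMinv, Matrix.mul_apply, Fin.sum_univ_three, S.unif_conj] <;>
    field_simp

lemma unif_inv_sq_mul_mem {y : S.E} {k : ℤ} : S.ϖ⁻¹ * S.ϖ⁻¹ * y ∈ S.pE (k - 2) ↔ y ∈ S.pE k := by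
  constructor
  · intro h
    have := pE_mul (pE_mul S.unif_mem_pE S.unif_mem_pE (le_refl (1 + 1))) h (l := k) (by omega)
    rwa [show S.ϖ * S.ϖ * (S.ϖ⁻¹ * S.ϖ⁻¹ * y) = y by have := S.unif_ne; field_simp] at this
  · intro h
    exact pE_mul (pE_mul S.unif_inv_mem_pE S.unif_inv_mem_pE (le_refl (-1 + -1))) h (by omega)

lemma alpha_conj_mem {k : ℤ} {u : S.GG} (hu : u ∈ S.NkSub k) :
    S.alphaE * u * S.alphaE⁻¹ ∈ S.NkSub (k - 2) := by
  obtain ⟨x, y, h, hy, rfl⟩ := mem_NkSub.1 hu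
  rw [alpha_conj_nE, nE_mem]
  exact unif_inv_sq_mul_mem.2 hy

lemma alpha_inv_conj_mem {k : ℤ} {u : S.GG} (hu : u ∈ S.NkSub (k - 2)) :
    S.alphaE⁻¹ * u * S.alphaE ∈ S.NkSub k := by
  obtain ⟨x, y, h, hy, rfl⟩ := mem_NkSub.1 hu
  have hz := S.unif_ne
  have e : nE x y h = S.alphaE * nE (S.ϖ * x) (S.ϖ * S.ϖ * y) (by
      simp only [map_mul, S.unif_conj]
      linear_combination S.ϖ * S.ϖ * h) * S.alphaE⁻¹ := by
    rw [alpha_conj_nE]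
    congr 1 <;> field_simp
  rw [e, show ∀ a b : S.GG, a⁻¹ * (a * b * a⁻¹) * a = b by intros; group, nE_mem,
    ← unif_inv_sq_mul_mem]
  rwa [show S.ϖ⁻¹ * S.ϖ⁻¹ * (S.ϖ * S.ϖ * y) = y by field_simp]

/-- The valuation of the top left entry. -/
def lam (g : S.GG) : ℤ := S.val (S.mat g 0 0)

lemma Bsub_inv_apply {b : S.GG} (hb : b ∈ S.Bsub) (i : Fin 3) :
    S.mat b i i * S.mat b⁻¹ i i = 1 := by
  have h1 : S.mat (b * b⁻¹) i i = 1 := by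
    rw [mul_inv_cancel, mat_one]
    simp
  have hb' := S.Bsub.inv_mem hb
  rw [mem_Bsub] at hb hb'
  rw [mat_mul_apply] at h1
  fin_cases i <;> simp_all

lemma Bsub_diag_ne {b : S.GG} (hb : b ∈ S.Bsub) (i : Fin 3) : S.mat b i i ≠ 0 :=
  left_ne_zero_of_mul_eq_one (Bsub_inv_apply hb i)

lemma lam_mul {a b : S.GG} (ha : a ∈ S.Bsub) (hb : b ∈ S.Bsub) :
    lam (a * b) = lam a + lam b := by
  have h1 := Bsub_diag_ne ha 0
  have h2 := Bsub_diag_ne hb 0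
  rw [mem_Bsub] at hb
  rw [lam, mat_mul_apply, hb.1, hb.2.1, mul_zero, mul_zero, add_zero, add_zero, S.val_mul h1 h2,
    lam, lam]

lemma lam_inv {a : S.GG} (ha : a ∈ S.Bsub) : lam a⁻¹ = - lam a := by
  have h1 := lam_mul ha (S.Bsub.inv_mem ha)
  have h2 : lam (1 : S.GG) = 0 := by simp [lam, mat_one, S.val_one]
  rw [mul_inv_cancel, h2] at h1
  omega

lemma lam_alpha : lam S.alphaE = -1 := by
  simp [lam, mat_alpha, alphaM, S.val_inv, S.val_unif]

lemma lam_of_mem_NkSub {k : ℤ} {u : S.GG} (hu : u ∈ S.NkSub k) : lam u = 0 := by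
  obtain ⟨x, y, h, hy, rfl⟩ := mem_NkSub.1 hu
  simp [lam, mat_nE, nM, S.val_one]

/-- An element whose bottom right entry divides the bottom left one up to `p_E^k` is moved into the
Borel subgroup by an element of `N'_k`. -/
lemma exists_mul_N'k_mem_Bsub {k : ℤ} (g : S.GG) (h0 : S.mat g 2 2 ≠ 0)
    (hr : S.mat g 2 0 / S.mat g 2 2 ∈ S.pE k) : ∃ n ∈ S.N'k k, g * n ∈ S.Bsub := by
  have hc : S.conj (S.mat g 2 2) ≠ 0 := fun h => h0 (S.conj_inj.1 h)
  have hiso := bottom_row_isotropic g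
  have key : (-S.conj (S.mat g 2 1 / S.mat g 2 2)) * S.conj (-S.conj (S.mat g 2 1 / S.mat g 2 2))
      + S.mat g 2 0 / S.mat g 2 2 + S.conj (S.mat g 2 0 / S.mat g 2 2) = 0 := by
    simp only [map_neg, map_div₀, S.conj_invol]
    field_simp
    linear_combination hiso
  refine ⟨(n'E _ _ key)⁻¹, N'k_inv (mem_N'k.2 ⟨_, _, key, hr, rfl⟩), ?_⟩
  set b := g * (n'E _ _ key)⁻¹
  have h20 : S.mat b 2 0 = 0 := by
    simp only [b, mat_mul_apply, n'E_inv, mat_n'E, n'M, Matrix.of_apply, Matrix.cons_val, map_div₀,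
      S.conj_invol, neg_neg]
    field_simp
    linear_combination hiso
  have h21 : S.mat b 2 1 = 0 := by
    simp only [b, mat_mul_apply, n'E_inv, mat_n'E, n'M, Matrix.of_apply, Matrix.cons_val, map_div₀,
      S.conj_invol, neg_neg]
    field_simp
    ring
  have h22 : S.mat b 2 2 ≠ 0 := by
    simpa [b, mat_mul_apply, n'E_inv, mat_n'E, n'M] using h0
  refine ⟨?_, h20, h21⟩
  have h : S.mat (b * b⁻¹) 1 0 = 0 := by
    rw [mul_inv_cancel, mat_one]
    simp
  rw [mat_mul_apply, mat_inv_apply, mat_inv_apply, mat_inv_apply] at h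
  simp only [Fin.reduceRev, h20, h21, map_zero, mul_zero, add_zero, mul_eq_zero, S.conj_inj, h22,
    or_false] at h
  exact h

/-- Iwasawa decomposition: `G = B * N'_{-c} * N_c`, in inverted form. -/
lemma exists_mul_mem_Bsub (c : ℤ) (g : S.GG) :
    ∃ u ∈ S.NkSub c, ∃ n ∈ S.N'k (-c), g * u * n ∈ S.Bsub := by
  obtain ⟨u, hu, h0, hr⟩ : ∃ u ∈ S.NkSub c, S.mat (g * u) 2 2 ≠ 0 ∧
      S.mat (g * u) 2 0 / S.mat (g * u) 2 2 ∈ S.pE (-c) := by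
    by_cases h : S.mat g 2 2 ≠ 0 ∧ S.mat g 2 0 / S.mat g 2 2 ∈ S.pE (-c)
    · exact ⟨1, one_mem _, by simpa using h⟩
    obtain ⟨d, hd0, hdv, hd⟩ := S.exists_trace_zero c
    have hd' : (0 : S.E) * S.conj 0 + d + S.conj d = 0 := by simpa using hd
    refine ⟨nE 0 d hd', nE_mem.2 (S.mem_pE.2 (Or.inr hdv.ge)), ?_⟩
    have e0 : S.mat (g * nE 0 d hd') 2 0 = S.mat g 2 0 := by
      simp [mat_mul_apply, mat_nE, nM]
    have e2 : S.mat (g * nE 0 d hd') 2 2 = S.mat g 2 0 * d + S.mat g 2 2 := by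
      simp [mat_mul_apply, mat_nE, nM]
    rw [e0, e2]
    set a := S.mat g 2 0
    set b := S.mat g 2 2
    have ha : a ≠ 0 := by
      intro ha
      by_cases hb : b = 0
      · have hiso := bottom_row_isotropic g
        have h1 : S.mat g 2 1 = 0 := by
          rw [show S.mat g 2 0 = 0 from ha, show S.mat g 2 2 = 0 from hb] at hiso
          simpa [S.conj_inj] using hiso
        have h2 : S.mat (g * g⁻¹) 2 2 = 1 := by
          rw [mul_inv_cancel, mat_one]
          simp
        rw [mat_mul_apply, h1, show S.mat g 2 0 = 0 from ha, show S.mat g 2 2 = 0 from hb] at h2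
        simp at h2
      · exact h ⟨hb, by rw [ha, zero_div]; exact pE_zero_mem _⟩
    have hb : b ∈ S.pE (S.val a + c + 1) := by
      by_cases hb : b = 0
      · exact hb ▸ pE_zero_mem _
      rw [S.mem_pE]
      right
      by_contra! hlt
      refine h ⟨hb, ?_⟩
      rw [S.mem_pE, div_eq_mul_inv, S.val_mul ha (inv_ne_zero hb), S.val_inv]
      omega
    have hn : a * d + b ∉ S.pE (S.val a + c + 1) := by
      intro hs
      have := pE_sub hs hb
      rw [add_sub_cancel_right, S.mem_pE, S.val_mul ha hd0, hdv] at this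
      rcases this with this | this
      · exact mul_ne_zero ha hd0 this
      · omega
    rw [S.mem_pE] at hn
    push Not at hn
    refine ⟨hn.1, ?_⟩
    rw [S.mem_pE, div_eq_mul_inv, S.val_mul ha (inv_ne_zero hn.1), S.val_inv]
    omega
  obtain ⟨n, hn, hb⟩ := exists_mul_N'k_mem_Bsub (g * u) h0 hr
  exact ⟨u, hu, n, hn, hb⟩

end Subgroups

end Setting

end U21

namespace U21

namespace Setting

/-! ### Coset representatives of `N_{k+m}` in `N_k` -/

section Reps

variable (S : Setting)

/-- The cosets of `N_{k+m}` in `N_k`. -/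
abbrev NkQuot (k m : ℤ) : Type := S.NkSub k ⧸ (S.NkSub (k + m)).subgroupOf (S.NkSub k)

/-- The residue class of an integral element (and `0` otherwise). -/
def resid (z : S.E) : S.kE := if h : z ∈ S.O then S.resmap ⟨z, h⟩ else 0

variable {S}

lemma sub_mem_pE_one_of_resid {z w : S.E} (hz : z ∈ S.O) (hw : w ∈ S.O)
    (h : S.resid z = S.resid w) : w - z ∈ S.pE 1 := by
  rw [resid, resid, dif_pos hz, dif_pos hw] at h
  obtain ⟨y, hy, e⟩ := (S.hmI _).1 (Ideal.Quotient.eq.1 h.symm)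
  exact ⟨y, hy, by simpa using e⟩

lemma sub_mem_pE_of_resid {z w : S.E} {k : ℤ} (hz : z ∈ S.pE k) (hw : w ∈ S.pE k)
    (h : S.resid (S.ϖ ^ (-k) * z) = S.resid (S.ϖ ^ (-k) * w)) : w - z ∈ S.pE (k + 1) := by
  have h1 := sub_mem_pE_one_of_resid
    (S.pE_zero_iff.1 (pE_mul (S.zpow_mem_pE (-k)) hz (by omega)))
    (S.pE_zero_iff.1 (pE_mul (S.zpow_mem_pE (-k)) hw (by omega))) h
  have h2 := pE_mul (S.zpow_mem_pE k) h1 le_rfl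
  have hz : S.ϖ ^ k ≠ 0 := zpow_ne_zero _ S.unif_ne
  rwa [← mul_sub, zpow_neg, mul_inv_cancel_left₀ hz] at h2

lemma inv_mul_mem_NkSub {a b : S.GG} {k : ℤ} (ha : a ∈ S.NkSub k) (hb : b ∈ S.NkSub k)
    (h0 : S.resid (S.ϖ ^ (-((k + 1) / 2)) * S.mat a 0 1) =
      S.resid (S.ϖ ^ (-((k + 1) / 2)) * S.mat b 0 1))
    (h1 : S.resid (S.ϖ ^ (-k) * S.mat a 0 2) = S.resid (S.ϖ ^ (-k) * S.mat b 0 2)) :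
    a⁻¹ * b ∈ S.NkSub (k + 1) := by
  obtain ⟨x, y, h, hy, rfl⟩ := mem_NkSub.1 ha
  obtain ⟨x', y', h', hy', rfl⟩ := mem_NkSub.1 hb
  simp only [mat_nE, nM, Matrix.of_apply, Matrix.cons_val] at h0 h1
  have hx := mem_pE_of_isotropic h hy (j := (k + 1) / 2) (by omega)
  have hx' := mem_pE_of_isotropic h' hy' (j := (k + 1) / 2) (by omega)
  rw [nE_inv, nE_mul, nE_mem,
    show S.conj y + y' - -x * S.conj x' = (y' - y) + x * S.conj (x' - x) by
      rw [map_sub]; linear_combination h]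
  exact pE_add (sub_mem_pE_of_resid hy hy' h1)
    (pE_mul hx (S.pE_conj (sub_mem_pE_of_resid hx hx' h0)) (by omega))

lemma mk_eq_iff {k m : ℤ} (a b : S.NkSub k) :
    (QuotientGroup.mk a : S.NkQuot k m) = QuotientGroup.mk b ↔
      (a : S.GG)⁻¹ * b ∈ S.NkSub (k + m) := by
  rw [QuotientGroup.eq, Subgroup.mem_subgroupOf]
  rfl

instance finite_NkQuot_one (k : ℤ) : Finite (S.NkQuot k 1) := by
  refine Finite.of_injective (β := S.kE × S.kE)
    (fun q => (S.resid (S.ϖ ^ (-((k + 1) / 2)) * S.mat q.out 0 1),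
      S.resid (S.ϖ ^ (-k) * S.mat q.out 0 2))) ?_
  intro q q' h
  rw [Prod.mk.injEq] at h
  have := inv_mul_mem_NkSub q.out.2 q'.out.2 h.1 h.2
  rwa [← mk_eq_iff, QuotientGroup.out_eq', QuotientGroup.out_eq'] at this

instance finite_NkQuot_two (k : ℤ) : Finite (S.NkQuot k 2) := by
  have h1 : (S.NkSub (k + 1)).relIndex (S.NkSub k) ≠ 0 :=
    (Nat.card_pos (α := S.NkQuot k 1)).ne'
  have h2 : (S.NkSub (k + 1 + 1)).relIndex (S.NkSub (k + 1)) ≠ 0 :=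
    (Nat.card_pos (α := S.NkQuot (k + 1) 1)).ne'
  have h3 := Subgroup.relIndex_mul_relIndex (S.NkSub (k + 1 + 1)) (S.NkSub (k + 1)) (S.NkSub k)
    (NkSub_mono (by omega)) (NkSub_mono (by omega))
  rw [add_assoc, one_add_one_eq_two] at h2 h3
  exact Nat.finite_of_card_ne_zero
    (show (S.NkSub (k + 2)).relIndex (S.NkSub k) ≠ 0 from h3 ▸ mul_ne_zero h2 h1)

lemma exists_isReps (k m : ℤ) [Finite (S.NkQuot k m)] :
    ∃ U : Finset S.GG, S.IsReps (S.Nk k) (S.Nk (k + m)) U ∧ U.card = Nat.card (S.NkQuot k m) := by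
  have := Fintype.ofFinite (S.NkQuot k m)
  refine ⟨Finset.univ.image fun q : S.NkQuot k m => (q.out : S.GG), ⟨?_, ?_⟩, ?_⟩
  · intro u hu
    simp only [Finset.coe_image, Finset.coe_univ, Set.image_univ, Set.mem_range] at hu
    obtain ⟨q, rfl⟩ := hu
    exact q.out.2
  · intro a ha
    refine ⟨((QuotientGroup.mk (⟨a, ha⟩ : S.NkSub k) : S.NkQuot k m).out : S.GG),
      ⟨Finset.mem_image_of_mem _ (Finset.mem_univ _), ?_⟩, ?_⟩
    · have := (mk_eq_iff (m := m) (⟨a, ha⟩ : S.NkSub k) (QuotientGroup.mk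
        (⟨a, ha⟩ : S.NkSub k) : S.NkQuot k m).out).1 (QuotientGroup.out_eq' _).symm
      exact this
    · rintro u ⟨hu, hau⟩
      obtain ⟨q, -, rfl⟩ := Finset.mem_image.1 hu
      have := (mk_eq_iff (m := m) (⟨a, ha⟩ : S.NkSub k) q.out).2 hau
      rw [QuotientGroup.out_eq'] at this
      simp [this]
  · rw [Finset.card_image_of_injective, Finset.card_univ, Nat.card_eq_fintype_card]
    intro q q' h
    exact Quotient.out_injective (Subtype.ext h)

lemma nE_zero_pow (d : S.E) (h : (0 : S.E) * S.conj 0 + d + S.conj d = 0) (m : ℕ) :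
    nE 0 d h ^ m = nE 0 ((m : S.E) * d) (by
      simp only [map_zero, mul_zero, zero_add, map_mul, map_natCast] at h ⊢
      rw [← mul_add, h, mul_zero]) := by
  induction m with
  | zero =>
    apply mat_ext
    ext i j
    fin_cases i <;> fin_cases j <;> simp [mat_one, mat_nE, nM]
  | succ m ih =>
    rw [pow_succ, ih, nE_mul]
    congr 1
    · simp
    · push_cast
      simp
      ring

variable (S) in
/-- The order of `N_k / N_{k+1}` is divisible by `p`. -/
lemma p_dvd_card_NkQuot (k : ℤ) : S.p ∣ Nat.card (S.NkQuot k 1) := by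
  have hp : Fact S.p.Prime := ⟨S.hp⟩
  obtain ⟨d, hd0, hdv, hd⟩ := S.exists_trace_zero k
  have hd' : (0 : S.E) * S.conj 0 + d + S.conj d = 0 := by simpa using hd
  have hdE : d ∈ S.pE k := S.mem_pE.2 (Or.inr hdv.ge)
  have hdk : nE 0 d hd' ∈ S.NkSub k := nE_mem.2 hdE
  have hp1 : nE 0 d hd' ^ S.p ∈ S.NkSub (k + 1) := by
    rw [nE_zero_pow, nE_mem]
    exact pE_mul S.natCast_p_mem hdE (by omega)
  set z : S.NkSub k := ⟨nE 0 d hd', hdk⟩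
  have hz : z ^ S.p ∈ (S.NkSub (k + 1)).subgroupOf (S.NkSub k) := hp1
  have hz1 : z ∉ (S.NkSub (k + 1)).subgroupOf (S.NkSub k) := by
    rw [Subgroup.mem_subgroupOf, nE_mem, S.mem_pE]
    push Not
    exact ⟨hd0, by omega⟩
  have hnorm : ((S.NkSub (k + 1)).subgroupOf (S.NkSub k)).Normal := by
    constructor
    rintro ⟨n, hn⟩ hn1 ⟨g, hg⟩
    rw [Subgroup.mem_subgroupOf] at hn1 ⊢
    obtain ⟨x, y, h, hy, rfl⟩ := mem_NkSub.1 hg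
    obtain ⟨x', y', h', hy', rfl⟩ := mem_NkSub.1 hn1
    have hx := mem_pE_of_isotropic h hy (j := (k + 1) / 2) (by omega)
    have hx' := mem_pE_of_isotropic h' hy' (j := (k + 2) / 2) (by omega)
    change nE x y h * nE x' y' h' * (nE x y h)⁻¹ ∈ S.NkSub (k + 1)
    rw [nE_inv, nE_mul, nE_mul, nE_mem,
      show y + y' - x * S.conj x' + S.conj y - (x + x') * S.conj (-x) =
        y' - x * S.conj x' + x' * S.conj x by rw [map_neg]; linear_combination h]
    exact pE_add (pE_sub hy' (pE_mul hx (S.pE_conj hx') (by omega)))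
      (pE_mul hx' (S.pE_conj hx) (by omega))
  have ho : orderOf (QuotientGroup.mk z : S.NkQuot k 1) = S.p := by
    apply orderOf_eq_prime
    · rw [← QuotientGroup.mk_pow, QuotientGroup.eq_one_iff]
      exact hz
    · rwa [Ne, QuotientGroup.eq_one_iff]
  rw [← ho]
  exact orderOf_dvd_natCard _

end Reps

/-- A sum over coset representatives of an indicator function supported on at most one coset. -/
lemma sum_ite_of_isReps {S : Setting} {R : Type} [AddCommMonoid R] {k l : ℤ} {U : Finset S.GG}
    (hU : S.IsReps (S.Nk k) (S.Nk l) U) (P : S.GG → Prop) (v : R)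
    (hP : ∀ a ∈ S.NkSub k, ∀ b ∈ S.NkSub l, P a → P (a * b))
    (huniq : ∀ a ∈ S.NkSub k, ∀ b ∈ S.NkSub k, P a → P b → a⁻¹ * b ∈ S.NkSub l) :
    ∑ u ∈ U, (if P u then v else 0) = if ∃ a ∈ S.NkSub k, P a then v else 0 := by
  split_ifs with h
  · obtain ⟨a, ha, hPa⟩ := h
    obtain ⟨u, ⟨huU, hau⟩, hu⟩ := hU.2 a ha
    have hPu : P u := by
      have := hP a ha _ hau hPa
      rwa [mul_inv_cancel_left] at this
    rw [Finset.sum_eq_single_of_mem u huU, if_pos hPu]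
    intro w hwU hwu
    rw [if_neg]
    exact fun hPw => hwu (hu w ⟨hwU, huniq a ha w (hU.1 hwU) hPa hPw⟩)
  · exact Finset.sum_eq_zero fun u huU => if_neg fun hPu => h ⟨u, hU.1 huU, hPu⟩

end Setting

/-- Let `t` be a function on a group whose support in the subgroup `B` lies in nonnegative
degree, with degree-zero part an invariance coset of `t`. Then a nonzero combination `f` of the
translates of `t` by `B` is nonzero and invariant under left translation by `J`
at some point of `B`. -/
lemma exists_constant_of_mem_span {G R : Type} [Group G] [Field R] (B : Subgroup G) (lam : G → ℤ)
    (hmul : ∀ a ∈ B, ∀ b ∈ B, lam (a * b) = lam a + lam b) (t : G → R) (D : Set G)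
    (J : Subgroup G) (hJB : J ≤ B) (hJ0 : ∀ v ∈ J, lam v = 0) (hJD : ∀ v ∈ J, v ∈ D)
    (hD : ∀ d ∈ D, ∀ g, t (g * d) = t g) (hpos : ∀ b ∈ B, t b ≠ 0 → 0 ≤ lam b)
    (hzero : ∀ b ∈ B, t b ≠ 0 → lam b = 0 → b ∈ D) (ht : t 1 ≠ 0) (f : G → R)
    (hf : f ∈ Submodule.span R {s | ∃ b ∈ B, s = fun x => t (x * b)}) (hf0 : f ≠ 0) :
    ∃ b ∈ B, f b ≠ 0 ∧ ∀ v ∈ J, f (v * b) = f b := by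
  have hinv : ∀ a ∈ B, lam a⁻¹ = -lam a := by
    intro a ha
    have h1 := hmul a ha _ (B.inv_mem ha)
    rw [mul_inv_cancel, hJ0 1 J.one_mem] at h1
    omega
  obtain ⟨c, hc, hcf⟩ := Submodule.mem_span_set.1 hf
  have hne : c.support.Nonempty := by
    rw [Finsupp.support_nonempty_iff]
    rintro rfl
    exact hf0 (by simpa using hcf.symm)
  have hc' : ∀ m ∈ c.support, ∃ b ∈ B, m = fun x => t (x * b) := fun m hm => hc hm
  choose! b hbB hb using hc'
  obtain ⟨m₀, hm₀, hmax⟩ := Finset.exists_max_image c.support (fun m => lam (b m)) hne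
  have heval : ∀ x, f x = ∑ m ∈ c.support, c m * t (x * b m) := by
    intro x
    rw [← hcf, Finsupp.sum, Finset.sum_apply]
    refine Finset.sum_congr rfl fun m hm => ?_
    rw [Pi.smul_apply, smul_eq_mul, congrFun (hb m hm) x]
  have hB0 := B.inv_mem (hbB m₀ hm₀)
  have hval : ∀ v ∈ J, f (v * (b m₀)⁻¹) = c m₀ * t 1 := by
    intro v hv
    rw [heval, Finset.sum_eq_single_of_mem m₀ hm₀]
    · rw [inv_mul_cancel_right, ← hD v (hJD v hv) 1, one_mul]
    · intro m hm hne'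
      by_contra h
      have h1 : t (v * (b m₀)⁻¹ * b m) ≠ 0 := right_ne_zero_of_mul h
      have hvB := B.mul_mem (hJB hv) hB0
      have hlam : lam (v * (b m₀)⁻¹ * b m) = lam (b m) - lam (b m₀) := by
        rw [hmul _ hvB _ (hbB m hm), hmul _ (hJB hv) _ hB0, hJ0 v hv, hinv _ (hbB m₀ hm₀)]
        ring
      have h2 := hpos _ (B.mul_mem hvB (hbB m hm)) h1
      have h3 := hmax m hm
      have hd := hzero _ (B.mul_mem hvB (hbB m hm)) h1 (by omega)
      refine hne' ?_
      refine (hb m hm).trans (Eq.trans (funext fun x => ?_) (hb m₀ hm₀).symm)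
      rw [show x * b m = x * b m₀ * v⁻¹ * (v * (b m₀)⁻¹ * b m) by group, hD _ hd,
        ← hD v (hJD v hv) (x * b m₀ * v⁻¹), inv_mul_cancel_right]
  have h1 := hval 1 J.one_mem
  rw [one_mul] at h1
  refine ⟨_, hB0, ?_, fun v hv => by rw [hval v hv, h1]⟩
  rw [h1]
  exact mul_ne_zero (Finsupp.mem_support_iff.1 hm₀) ht

end U21

namespace U21

namespace Setting

variable {S : Setting}

lemma eq_nE_of_mem_Bsub {g : S.GG} (hg : g ∈ S.Bsub) (h1 : ∀ i, S.mat g i i = 1) :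
    ∃ h, g = nE (S.mat g 0 1) (S.mat g 0 2) h := by
  have e02 : S.mat (g * g⁻¹) 0 2 = 0 := by
    rw [mul_inv_cancel, mat_one]
    simp
  have e12 : S.mat (g * g⁻¹) 1 2 = 0 := by
    rw [mul_inv_cancel, mat_one]
    simp
  obtain ⟨h10, h20, h21⟩ := mem_Bsub.1 hg
  simp only [mat_mul_apply, mat_inv_apply, Fin.reduceRev, h1, h10, map_one, zero_mul, one_mul,
    mul_one, zero_add] at e02 e12
  refine ⟨by linear_combination e02, mat_ext ?_⟩
  ext i j
  fin_cases i <;> fin_cases j <;>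
    simp [mat_nE, nM, h1, h10, h20, h21, eq_neg_of_add_eq_zero_right e12]

end Setting

namespace Chamber

open Setting

variable {S : Setting} (C : Chamber S)

/-! ### Uniform description of the two maximal compact subgroups -/

lemma nK_eq : C.nK = 0 ∨ C.nK = -1 := by
  rcases C.cases with h | h
  · exact Or.inl h.2.2.2.2.2.2.1
  · exact Or.inr h.2.2.2.2.2.2.1

lemma mem_K {g : S.GG} : g ∈ C.K ↔
    (S.mat g 0 0 ∈ S.pE 0 ∧ S.mat g 0 1 ∈ S.pE 0 ∧ S.mat g 0 2 ∈ S.pE C.nK) ∧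
    (S.mat g 1 0 ∈ S.pE (-C.nK) ∧ S.mat g 1 1 ∈ S.pE 0 ∧ S.mat g 1 2 ∈ S.pE 0) ∧
    S.mat g 2 0 ∈ S.pE (-C.nK) ∧ S.mat g 2 1 ∈ S.pE (-C.nK) ∧ S.mat g 2 2 ∈ S.pE 0 := by
  rw [← SetLike.mem_coe]
  rcases C.cases with ⟨h, -, -, -, -, -, hn, -⟩ | ⟨h, -, -, -, -, -, hn, -⟩
  · rw [h, hn]
    simp only [K0set, Set.mem_ofPred_eq, Fin.forall_fin_succ, neg_zero, S.pE_zero_iff]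
    simp
  · rw [h, hn]
    simp only [K1set, Set.mem_ofPred_eq, neg_neg, S.pE_zero_iff]
    tauto

lemma mem_K_of_mem_I1 {g : S.GG} (hg : g ∈ C.I1) : g ∈ C.K := by
  rw [← SetLike.mem_coe]
  rcases C.cases with ⟨h, -, -, h', -⟩ | ⟨h, -, -, h', -⟩
  · rw [h' ] at hg
    rw [h]
    exact hg.1.1
  · rw [h'] at hg
    rw [h]
    exact hg.1.1

lemma mem_I1 {g : S.GG} : g ∈ C.I1 ↔ g ∈ C.K ∧
    (S.mat g 1 0 ∈ S.pE 1 ∧ S.mat g 2 0 ∈ S.pE (1 - C.nK) ∧ S.mat g 2 1 ∈ S.pE 1) ∧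
    S.mat g 0 0 - 1 ∈ S.pE 1 ∧ S.mat g 1 1 - 1 ∈ S.pE 1 ∧ S.mat g 2 2 - 1 ∈ S.pE 1 := by
  rw [← SetLike.mem_coe (p := C.K)]
  rcases C.cases with ⟨h, -, -, h', -, -, hn, -⟩ | ⟨h, -, -, h', -, -, hn, -⟩
  · rw [h, h', hn]
    simp only [I1K0, IK0, Set.mem_ofPred_eq, sub_zero]
    tauto
  · rw [h, h', hn]
    simp only [I1K1, IK1, K1set, Set.mem_ofPred_eq]
    norm_num
    tauto

lemma mat_βK : S.mat C.βK = !![0, 0, S.ϖ ^ C.nK; 0, 1, 0; S.ϖ ^ (-C.nK), 0, 0] := by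
  rcases C.cases with ⟨-, -, -, -, -, h, hn, -⟩ | ⟨-, -, -, -, -, h, hn, -⟩
  · rw [h, hn, neg_zero, zpow_zero]
    rfl
  · rw [h, hn, betaPr, mat_mul, mat_alpha_inv, show S.mat S.betaE = S.betaM from rfl]
    ext i j
    fin_cases i <;> fin_cases j <;>
      simp [betaM, alphaMinv, Matrix.mul_apply, Fin.sum_univ_three]

lemma βK_mem : C.βK ∈ C.K := by
  rw [C.mem_K, mat_βK]
  have := S.zpow_mem_pE (-C.nK)
  rw [zpow_neg] at this
  simp [pE_zero_mem, zpow_mem_pE, one_mem_pE, this]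

lemma βK_mul_self : C.βK * C.βK = 1 := by
  apply mat_ext
  have := zpow_ne_zero C.nK S.unif_ne
  rw [mat_mul, mat_βK, mat_one]
  ext i j
  fin_cases i <;> fin_cases j <;> simp [Matrix.mul_apply, Fin.sum_univ_three, this]

lemma βK_conj_alpha_inv : C.βK * S.alphaE⁻¹ * C.βK = S.alphaE := by
  apply mat_ext
  have := zpow_ne_zero C.nK S.unif_ne
  rw [mat_mul, mat_mul, mat_βK, mat_alpha_inv, mat_alpha]
  ext i j
  fin_cases i <;> fin_cases j <;>
    simp [Matrix.mul_apply, Fin.sum_univ_three, alphaM, alphaMinv] <;> field_simp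

/-- Conjugation by `β_K` maps `N_{n_K + 1}` to `N'_{1 - n_K}`. -/
lemma βK_conj_mem_N'k {u : S.GG} (hu : u ∈ S.NkSub (C.nK + 1)) :
    C.βK * u * C.βK ∈ S.N'k (1 - C.nK) := by
  obtain ⟨x, y, h, hy, rfl⟩ := mem_NkSub.1 hu
  have hz := zpow_ne_zero C.nK S.unif_ne
  refine ⟨-(S.ϖ ^ (-C.nK) * S.conj x), S.ϖ ^ (-C.nK) * S.ϖ ^ (-C.nK) * y, ?_, ?_, ?_⟩
  · simp only [map_neg, map_mul, map_zpow₀, S.unif_conj, S.conj_invol]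
    linear_combination S.ϖ ^ (-C.nK) * S.ϖ ^ (-C.nK) * h
  · exact pE_mul (pE_mul (S.zpow_mem_pE _) (S.zpow_mem_pE _) le_rfl) hy (by omega)
  · rw [mat_mul, mat_mul, mat_βK, mat_nE]
    ext i j
    fin_cases i <;> fin_cases j <;>
      simp [Matrix.mul_apply, Fin.sum_univ_three, nM, n'M, S.unif_conj, S.conj_invol, hz] <;>
      ring

/-- Conjugation by `β_K` maps `N'_{1 - n_K}` to `N_{n_K + 1}`. -/
lemma βK_conj_mem_NkSub {u : S.GG} (hu : u ∈ S.N'k (1 - C.nK)) :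
    C.βK * u * C.βK ∈ S.NkSub (C.nK + 1) := by
  obtain ⟨x, y, h, hy, rfl⟩ := mem_N'k.1 hu
  have hz := zpow_ne_zero C.nK S.unif_ne
  refine ⟨-(S.ϖ ^ C.nK * S.conj x), S.ϖ ^ C.nK * S.ϖ ^ C.nK * y, ?_, ?_, ?_⟩
  · simp only [map_neg, map_mul, map_zpow₀, S.unif_conj, S.conj_invol]
    linear_combination S.ϖ ^ C.nK * S.ϖ ^ C.nK * h
  · exact pE_mul (pE_mul (S.zpow_mem_pE _) (S.zpow_mem_pE _) le_rfl) hy (by omega)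
  · rw [mat_mul, mat_mul, mat_βK, mat_n'E]
    ext i j
    fin_cases i <;> fin_cases j <;>
      simp [Matrix.mul_apply, Fin.sum_univ_three, nM, n'M, S.unif_conj, S.conj_invol, hz] <;>
      ring

/-! ### Unipotent elements and the Borel subgroup -/

lemma nE_mem_K {x y : S.E} {h} : nE x y h ∈ C.K ↔ y ∈ S.pE C.nK := by
  constructor
  · intro hK
    simpa [mat_nE, nM] using (C.mem_K.1 hK).1.2.2
  · intro hy
    have hx := mem_pE_of_isotropic h hy (j := 0) (by rcases C.nK_eq with h | h <;> omega)
    rw [C.mem_K]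
    simp [mat_nE, nM, pE_zero_mem, one_mem_pE, hy, hx, pE_neg, S.pE_conj]

lemma NkSub_le_K {k : ℤ} (hk : C.nK ≤ k) : S.NkSub k ≤ C.K := by
  intro u hu
  obtain ⟨x, y, h, hy, rfl⟩ := mem_NkSub.1 hu
  exact C.nE_mem_K.2 (pE_mono hy hk)

lemma mem_NkSub_of_mem_K {k : ℤ} {u : S.GG} (hu : u ∈ S.NkSub k) (hK : u ∈ C.K) :
    u ∈ S.NkSub C.nK := by
  obtain ⟨x, y, h, hy, rfl⟩ := mem_NkSub.1 hu
  exact nE_mem.2 (C.nE_mem_K.1 hK)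

lemma n'E_mem_K {x y : S.E} {h} (hy : y ∈ S.pE (-C.nK)) : n'E x y h ∈ C.K := by
  have hx := mem_pE_of_isotropic h hy (j := -C.nK) (by rcases C.nK_eq with h | h <;> omega)
  rw [C.mem_K]
  simp [mat_n'E, n'M, pE_zero_mem, one_mem_pE, hy, hx, pE_neg, S.pE_conj]

lemma N'k_subset_I1 {u : S.GG} (hu : u ∈ S.N'k (1 - C.nK)) : u ∈ C.I1 := by
  obtain ⟨x, y, h, hy, rfl⟩ := mem_N'k.1 hu
  have hx := mem_pE_of_isotropic h hy (j := 1) (by rcases C.nK_eq with h | h <;> omega)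
  rw [C.mem_I1]
  refine ⟨C.n'E_mem_K (pE_mono hy (by omega)), ?_⟩
  simp [mat_n'E, n'M, pE_zero_mem, hy, hx, pE_neg, S.pE_conj]

lemma lam_eq_zero {k : S.GG} (hK : k ∈ C.K) (hB : k ∈ S.Bsub) : lam k = 0 := by
  have key : ∀ {k : S.GG}, k ∈ C.K → k ∈ S.Bsub → 0 ≤ lam k := by
    intro k hK hB
    exact (S.mem_pE.1 (C.mem_K.1 hK).1.1).resolve_left (Bsub_diag_ne hB 0)
  have h1 := key hK hB
  have h2 := key (C.K.inv_mem hK) (S.Bsub.inv_mem hB)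
  rw [lam_inv hB] at h2
  omega

/-- `K ∩ B` normalizes `N_j` for `j ≤ 1`. -/
lemma conj_mem_NkSub {j : ℤ} (hj : j ≤ 1) {b v : S.GG} (hK : b ∈ C.K) (hB : b ∈ S.Bsub)
    (hv : v ∈ S.NkSub j) : b⁻¹ * v * b ∈ S.NkSub j := by
  have hgB := S.Bsub.mul_mem (S.Bsub.mul_mem (S.Bsub.inv_mem hB) (NkSub_le_Bsub _ hv)) hB
  have hd := Bsub_inv_apply hB
  have hB' := S.Bsub.inv_mem hB
  have hI := C.mem_K.1 (C.K.inv_mem hK)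
  have hM := C.mem_K.1 hK
  have e02 : S.mat (b⁻¹ * b) 0 2 = 0 := by
    rw [inv_mul_cancel, mat_one]
    simp
  obtain ⟨x, y, h, hy, rfl⟩ := mem_NkSub.1 hv
  have hx := mem_pE_of_isotropic h hy (j := j) (by omega)
  rw [mem_Bsub] at hB hB'
  obtain ⟨h', e⟩ := eq_nE_of_mem_Bsub hgB (fun i => by
    rw [← hd i]
    fin_cases i <;> simp [mat_mul_apply, mat_nE, nM, hB, hB', mul_comm])
  rw [e, nE_mem]
  have e' : S.mat (b⁻¹ * nE x y h * b) 0 2 = S.mat b⁻¹ 0 0 * (x * S.mat b 1 2 + y * S.mat b 2 2)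
      - S.mat b⁻¹ 0 1 * (S.conj x * S.mat b 2 2) := by
    rw [mat_mul_apply] at e02
    simp [mat_mul_apply, mat_nE, nM]
    linear_combination e02
  rw [e']
  exact pE_sub (pE_mul hI.1.1 (pE_add (pE_mul hx hM.2.1.2.2 (by omega))
    (pE_mul hy hM.2.2.2.2 (by omega))) (by omega : j ≤ 0 + j))
    (pE_mul hI.1.2.1 (pE_mul (S.pE_conj hx) hM.2.2.2.2 (by omega)) (by omega : j ≤ 0 + j))

lemma alpha_conj_mem_K {b : S.GG} (hK : b ∈ C.K) (hB : b ∈ S.Bsub) :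
    S.alphaE⁻¹ * b * S.alphaE ∈ C.K := by
  have hM := C.mem_K.1 hK
  have hz := S.unif_ne
  have hB' := mem_Bsub.1 hB
  have h01 := pE_mul S.unif_mem_pE hM.1.2.1 (l := 0) (by omega)
  have h02 := pE_mul (pE_mul S.unif_mem_pE S.unif_mem_pE le_rfl) hM.1.2.2 (l := C.nK) (by omega)
  have h12 := pE_mul hM.2.1.2.2 S.unif_mem_pE (l := 0) (by omega)
  rw [C.mem_K]
  simp [mat_mul_apply, mat_alpha, mat_alpha_inv, alphaM, alphaMinv, hB', pE_zero_mem, h01, h02,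
    h12, mul_right_comm S.ϖ, mul_right_comm S.ϖ⁻¹, hz, hM]

lemma N'k_conj_alpha_mem_K {x y : S.E} {h} (hy : y ∈ S.pE (2 - C.nK)) :
    S.alphaE⁻¹ * n'E x y h * S.alphaE ∈ C.K := by
  rw [alpha_conj_n'E]
  refine C.n'E_mem_K ?_
  rw [show -C.nK = 2 - C.nK - 2 by omega]
  exact unif_inv_sq_mul_mem.2 hy

/-- Relation between the double cosets of `α` seen through `N` and through `N'`. -/
lemma nE_mul_n'E_mul_alpha_mem {x y : S.E} (h) (h') (hy0 : y ≠ 0) (hy : S.val y = C.nK - 1) :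
    nE x y h * n'E (S.conj x / S.conj y) (S.conj y)⁻¹ h' * S.alphaE ∈ C.K := by
  have hc0 : S.conj y ≠ 0 := fun e => hy0 (S.conj_inj.1 e)
  have hyp : y ∈ S.pE (C.nK - 1) := S.mem_pE.2 (Or.inr hy.ge)
  have hiy : y⁻¹ ∈ S.pE (1 - C.nK) := S.mem_pE.2 (Or.inr (by rw [S.val_inv]; omega))
  have hic : (S.conj y)⁻¹ ∈ S.pE (1 - C.nK) := by
    rw [← map_inv₀]
    exact S.pE_conj hiy
  have hn := C.nK_eq
  have hx := mem_pE_of_isotropic h hyp (j := C.nK) (by rcases C.nK_eq with h | h <;> omega)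
  have e : S.mat (nE x y h * n'E (S.conj x / S.conj y) (S.conj y)⁻¹ h' * S.alphaE) =
      !![0, 0, y * S.ϖ; 0, -(S.conj y * y⁻¹), -(S.conj x * S.ϖ);
        (S.conj y)⁻¹ * S.ϖ⁻¹, -(x * y⁻¹), S.ϖ] := by
    rw [mat_mul, mat_mul, mat_nE, mat_n'E, mat_alpha]
    ext i j
    fin_cases i <;> fin_cases j <;>
      simp [Matrix.mul_apply, Fin.sum_univ_three, nM, n'M, alphaM, S.conj_invol, -mul_eq_zero] <;>
      field_simp <;> first | ring1 | linear_combination h | linear_combination -h | linear_combination S.ϖ⁻¹ * h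
  rw [C.mem_K, e]
  simp only [Matrix.of_apply, Matrix.cons_val]
  refine ⟨⟨pE_zero_mem _, pE_zero_mem _, pE_mul hyp S.unif_mem_pE (by omega)⟩,
    ⟨pE_zero_mem _, pE_neg (pE_mul (S.pE_conj hyp) hiy (by omega)),
      pE_neg (pE_mul (S.pE_conj hx) S.unif_mem_pE (by omega))⟩,
    pE_mul hic S.unif_inv_mem_pE (by omega), pE_neg (pE_mul hx hiy (by omega)),
    pE_mono S.unif_mem_pE (by omega)⟩

end Chamber

end U21

namespace U21

namespace Chamber

open Setting

variable {S : Setting} (C : Chamber S)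

/-! ### The cosets supporting `f₁`, `f₀ + f₁` and `T f₀` -/

/-- `g` lies in the support of `f₁`. -/
def InOpp (g : S.GG) : Prop := ∃ n ∈ S.N'k (1 - C.nK), g * n * S.alphaE ∈ C.K

/-- `g` lies in `K * N_j`. -/
def InKN (j : ℤ) (g : S.GG) : Prop := ∃ u ∈ S.NkSub j, g * u ∈ C.K

/-- `g` lies in `K * α * N_{n_K}`. -/
def InAlpha (g : S.GG) : Prop := ∃ u ∈ S.NkSub C.nK, g * u * S.alphaE⁻¹ ∈ C.K

variable {C}

lemma notMem_K_of_apply {g : S.GG} (h : S.mat g 0 0 = S.ϖ⁻¹) : g ∉ C.K := by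
  intro hK
  have := (C.mem_K.1 hK).1.1
  rw [h, S.mem_pE, S.val_inv, S.val_unif] at this
  rcases this with h | h
  · exact inv_ne_zero S.unif_ne h
  · omega

lemma not_inOpp_of_mem {g : S.GG} (hg : g ∈ C.K) : ¬ C.InOpp g := by
  rintro ⟨n, hn, h⟩
  rw [mul_assoc, C.K.mul_mem_cancel_left hg] at h
  obtain ⟨x, y, e, -, rfl⟩ := mem_N'k.1 hn
  refine notMem_K_of_apply ?_ h
  simp [mat_mul_apply, mat_n'E, n'M, mat_alpha, alphaM]

lemma not_inKN_of_mul_alpha_mem {j : ℤ} {g : S.GG} (hg : g * S.alphaE ∈ C.K) : ¬ C.InKN j g := by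
  rintro ⟨u, hu, h⟩
  have h' := C.K.mul_mem (C.K.inv_mem h) hg
  rw [show (g * u)⁻¹ * (g * S.alphaE) = u⁻¹ * S.alphaE by group] at h'
  obtain ⟨x, y, e, -, e'⟩ := mem_NkSub.1 ((S.NkSub j).inv_mem hu)
  rw [e'] at h'
  refine notMem_K_of_apply ?_ h'
  simp [mat_mul_apply, mat_nE, nM, mat_alpha, alphaM]

lemma exists_N'k_of_notMem_K {u : S.GG} (hu : u ∈ S.NkSub (C.nK - 1)) (hK : u ∉ C.K) :
    ∃ n ∈ S.N'k (1 - C.nK), u * n * S.alphaE ∈ C.K := by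
  obtain ⟨x, y, h, hy, rfl⟩ := mem_NkSub.1 hu
  rw [C.nE_mem_K, S.mem_pE] at hK
  push Not at hK
  obtain ⟨hy0, hyv⟩ := hK
  have hc0 : S.conj y ≠ 0 := fun e => hy0 (S.conj_inj.1 e)
  have hval : S.val y = C.nK - 1 := by
    have := (S.mem_pE.1 hy).resolve_left hy0
    omega
  have h' : S.conj x / S.conj y * S.conj (S.conj x / S.conj y) + (S.conj y)⁻¹ +
      S.conj (S.conj y)⁻¹ = 0 := by
    simp only [map_div₀, map_inv₀, S.conj_invol]
    field_simp
    linear_combination h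
  refine ⟨n'E _ _ h', mem_N'k.2 ⟨_, _, h', ?_, rfl⟩, C.nE_mul_n'E_mul_alpha_mem h h' hy0 hval⟩
  rw [S.mem_pE, S.val_inv, S.val_conj]
  omega

lemma exists_NkSub_of_notMem_K {n : S.GG} (hn : n ∈ S.N'k (1 - C.nK))
    (hK : S.alphaE⁻¹ * n * S.alphaE ∉ C.K) :
    ∃ u ∈ S.NkSub (C.nK - 1), u * n * S.alphaE ∈ C.K := by
  obtain ⟨a, b, h', hb, rfl⟩ := mem_N'k.1 hn
  have hb' : b ∉ S.pE (2 - C.nK) := fun hb => hK (C.N'k_conj_alpha_mem_K hb)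
  rw [S.mem_pE] at hb'
  push Not at hb'
  obtain ⟨hb0, hbv⟩ := hb'
  have hc0 : S.conj b ≠ 0 := fun e => hb0 (S.conj_inj.1 e)
  have hval : S.val b = 1 - C.nK := by
    have := (S.mem_pE.1 hb).resolve_left hb0
    omega
  have h : S.conj a / S.conj b * S.conj (S.conj a / S.conj b) + (S.conj b)⁻¹ +
      S.conj (S.conj b)⁻¹ = 0 := by
    simp only [map_div₀, map_inv₀, S.conj_invol]
    field_simp
    linear_combination h'
  have hv : S.val (S.conj b)⁻¹ = C.nK - 1 := by
    rw [S.val_inv, S.val_conj]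
    omega
  refine ⟨nE _ _ h, nE_mem.2 (S.mem_pE.2 (Or.inr hv.ge)), ?_⟩
  have ea : S.conj (S.conj a / S.conj b) / S.conj (S.conj b)⁻¹ = a := by
    simp only [map_div₀, map_inv₀, S.conj_invol]
    field_simp
  have eb : (S.conj (S.conj b)⁻¹)⁻¹ = b := by
    simp only [map_inv₀, S.conj_invol, inv_inv]
  have := C.nE_mul_n'E_mul_alpha_mem h (by rwa [ea, eb]) (inv_ne_zero hc0) hv
  simpa only [ea, eb] using this

/-- The two descriptions of the support of `f₀ + f₁`. -/
lemma mem_or_inOpp_iff (g : S.GG) :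
    g ∈ C.K ∨ C.InOpp g ↔ g * S.alphaE ∈ C.K ∨ C.InKN (C.nK - 1) g := by
  constructor
  · rintro (hg | ⟨n, hn, hg⟩)
    · exact Or.inr ⟨1, one_mem _, by rwa [mul_one]⟩
    by_cases hK : S.alphaE⁻¹ * n * S.alphaE ∈ C.K
    · left
      rwa [show g * n * S.alphaE = g * S.alphaE * (S.alphaE⁻¹ * n * S.alphaE) by group,
        C.K.mul_mem_cancel_right hK] at hg
    · obtain ⟨u, hu, h⟩ := exists_NkSub_of_notMem_K hn hK
      refine Or.inr ⟨u⁻¹, inv_mem hu, ?_⟩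
      rwa [show g * n * S.alphaE = g * u⁻¹ * (u * n * S.alphaE) by group,
        C.K.mul_mem_cancel_right h] at hg
  · rintro (hg | ⟨u, hu, hg⟩)
    · refine Or.inr ⟨1, ?_, by rwa [mul_one]⟩
      exact ⟨0, 0, by simp, pE_zero_mem _, by
        rw [mat_one]
        ext i j
        fin_cases i <;> fin_cases j <;> simp [n'M]⟩
    · by_cases hK : u⁻¹ ∈ C.K
      · left
        rwa [C.K.mul_mem_cancel_right ((C.K.inv_mem_iff).1 hK)] at hg
      · obtain ⟨n, hn, h⟩ := exists_N'k_of_notMem_K (inv_mem hu) hK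
        refine Or.inr ⟨n, hn, ?_⟩
        rw [show g * n * S.alphaE = g * u * (u⁻¹ * n * S.alphaE) by group]
        exact C.K.mul_mem hg h

/-! ### Behaviour on cosets of the groups `N_k` -/

lemma inv_mul_mem_of_mul_alpha_inv_mem {j : ℤ} {g a b : S.GG} (ha : a ∈ S.NkSub j)
    (hb : b ∈ S.NkSub j) (hga : g * a * S.alphaE⁻¹ ∈ C.K) (hgb : g * b * S.alphaE⁻¹ ∈ C.K) :
    a⁻¹ * b ∈ S.NkSub (C.nK + 2) := by
  have h := C.K.mul_mem (C.K.inv_mem hga) hgb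
  rw [show (g * a * S.alphaE⁻¹)⁻¹ * (g * b * S.alphaE⁻¹) = S.alphaE * (a⁻¹ * b) * S.alphaE⁻¹ by
    group] at h
  have h1 := C.mem_NkSub_of_mem_K (alpha_conj_mem (mul_mem (inv_mem ha) hb)) h
  have := alpha_inv_conj_mem (k := C.nK + 2) (by rwa [add_sub_cancel_right])
  rwa [show S.alphaE⁻¹ * (S.alphaE * (a⁻¹ * b) * S.alphaE⁻¹) * S.alphaE = a⁻¹ * b by group] at this

lemma mul_mul_alpha_inv_mem {g a b : S.GG} (hb : b ∈ S.NkSub (C.nK + 2))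
    (hga : g * a * S.alphaE⁻¹ ∈ C.K) : g * (a * b) * S.alphaE⁻¹ ∈ C.K := by
  rw [show g * (a * b) * S.alphaE⁻¹ = g * a * S.alphaE⁻¹ * (S.alphaE * b * S.alphaE⁻¹) by group]
  exact C.K.mul_mem hga (C.NkSub_le_K (by omega) (alpha_conj_mem hb))

lemma inKN_mul_iff {j : ℤ} {g u : S.GG} (hu : u ∈ S.NkSub j) : C.InKN j (g * u) ↔ C.InKN j g := by
  constructor
  · rintro ⟨w, hw, h⟩
    exact ⟨u * w, mul_mem hu hw, by rwa [← mul_assoc]⟩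
  · rintro ⟨w, hw, h⟩
    exact ⟨u⁻¹ * w, mul_mem (inv_mem hu) hw, by rwa [mul_assoc, mul_inv_cancel_left]⟩

lemma inKN_mul_mul_alpha_inv {g a b : S.GG} (hb : b ∈ S.NkSub (C.nK + 1))
    (h : C.InKN (C.nK - 1) (g * a * S.alphaE⁻¹)) :
    C.InKN (C.nK - 1) (g * (a * b) * S.alphaE⁻¹) := by
  rw [show g * (a * b) * S.alphaE⁻¹ = g * a * S.alphaE⁻¹ * (S.alphaE * b * S.alphaE⁻¹) by group]
  have := alpha_conj_mem hb
  rw [show C.nK + 1 - 2 = C.nK - 1 by omega] at this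
  rwa [inKN_mul_iff this]

lemma inv_mul_mem_of_inKN {j : ℤ} {g a b : S.GG} (ha : a ∈ S.NkSub j)
    (hb : b ∈ S.NkSub j) (hga : C.InKN (C.nK - 1) (g * a * S.alphaE⁻¹))
    (hgb : C.InKN (C.nK - 1) (g * b * S.alphaE⁻¹)) : a⁻¹ * b ∈ S.NkSub (C.nK + 1) := by
  obtain ⟨w, hw, hga⟩ := hga
  obtain ⟨w', hw', hgb⟩ := hgb
  have h := C.K.mul_mem (C.K.inv_mem hga) hgb
  set c := S.alphaE * (a⁻¹ * b) * S.alphaE⁻¹ with hc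
  rw [show (g * a * S.alphaE⁻¹ * w)⁻¹ * (g * b * S.alphaE⁻¹ * w') = w⁻¹ * c * w' by
    rw [hc]; group] at h
  have hm : w⁻¹ * c * w' ∈ S.NkSub (min (C.nK - 1) (j - 2)) :=
    mul_mem (mul_mem (NkSub_mono (min_le_left _ _) (inv_mem hw))
      (NkSub_mono (min_le_right _ _) (alpha_conj_mem (mul_mem (inv_mem ha) hb))))
      (NkSub_mono (min_le_left _ _) hw')
  have h1 := NkSub_mono (show C.nK - 1 ≤ C.nK by omega) (C.mem_NkSub_of_mem_K hm h)
  have h2 := mul_mem (mul_mem hw h1) (inv_mem hw')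
  rw [show w * (w⁻¹ * c * w') * w'⁻¹ = c by group,
    show C.nK - 1 = C.nK + 1 - 2 by omega] at h2
  have := alpha_inv_conj_mem h2
  rwa [show S.alphaE⁻¹ * c * S.alphaE = a⁻¹ * b by rw [hc]; group] at this

lemma exists_inKN_iff (g : S.GG) :
    (∃ a ∈ S.NkSub C.nK, C.InKN (C.nK - 1) (g * a * S.alphaE⁻¹)) ↔ C.InAlpha g := by
  constructor
  · rintro ⟨a, ha, w, hw, h⟩
    have hw' : S.alphaE⁻¹ * w * S.alphaE ∈ S.NkSub (C.nK + 1) :=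
      alpha_inv_conj_mem (by rwa [show C.nK + 1 - 2 = C.nK - 1 by omega])
    refine ⟨a * (S.alphaE⁻¹ * w * S.alphaE), mul_mem ha (NkSub_mono (by omega) hw'), ?_⟩
    rwa [show g * (a * (S.alphaE⁻¹ * w * S.alphaE)) * S.alphaE⁻¹ = g * a * S.alphaE⁻¹ * w by group]
  · rintro ⟨a, ha, h⟩
    exact ⟨a, ha, 1, one_mem _, by rwa [mul_one]⟩

lemma exists_βK_mul_iff (g : S.GG) :
    (∃ u ∈ S.NkSub (C.nK + 1), g * C.βK * u * S.alphaE⁻¹ ∈ C.K) ↔ C.InOpp g := by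
  have hβ := C.βK_mul_self
  have key : ∀ u n : S.GG, C.βK * u * C.βK = n →
      (g * C.βK * u * S.alphaE⁻¹ ∈ C.K ↔ g * n * S.alphaE ∈ C.K) := by
    rintro u n rfl
    have e : g * (C.βK * u * C.βK) * S.alphaE = g * C.βK * u * S.alphaE⁻¹ * C.βK := by
      calc g * (C.βK * u * C.βK) * S.alphaE
          = g * (C.βK * u * C.βK) * (C.βK * S.alphaE⁻¹ * C.βK) := by rw [C.βK_conj_alpha_inv]
        _ = g * C.βK * u * (C.βK * C.βK) * S.alphaE⁻¹ * C.βK := by group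
        _ = g * C.βK * u * S.alphaE⁻¹ * C.βK := by rw [hβ, mul_one]
    rw [e, C.K.mul_mem_cancel_right C.βK_mem]
  constructor
  · rintro ⟨u, hu, h⟩
    exact ⟨_, C.βK_conj_mem_N'k hu, (key u _ rfl).1 h⟩
  · rintro ⟨n, hn, h⟩
    refine ⟨_, C.βK_conj_mem_NkSub hn, (key _ n ?_).2 h⟩
    rw [show C.βK * (C.βK * n * C.βK) * C.βK = (C.βK * C.βK) * n * (C.βK * C.βK) by group, hβ,
      one_mul, mul_one]

/-! ### Invariance under `K ∩ B` -/

lemma mul_alpha_mem_iff {g k : S.GG} (hK : k ∈ C.K) (hB : k ∈ S.Bsub) :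
    g * k * S.alphaE ∈ C.K ↔ g * S.alphaE ∈ C.K := by
  rw [show g * k * S.alphaE = g * S.alphaE * (S.alphaE⁻¹ * k * S.alphaE) by group,
    C.K.mul_mem_cancel_right (C.alpha_conj_mem_K hK hB)]

lemma mul_alpha_mem_iff_of_mem_NkSub {g u : S.GG} (hu : u ∈ S.NkSub (C.nK - 2)) :
    g * u * S.alphaE ∈ C.K ↔ g * S.alphaE ∈ C.K := by
  rw [show g * u * S.alphaE = g * S.alphaE * (S.alphaE⁻¹ * u * S.alphaE) by group,
    C.K.mul_mem_cancel_right (C.NkSub_le_K le_rfl (alpha_inv_conj_mem hu))]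

lemma inKN_mul_iff_of_mem_K {j : ℤ} (hj : j ≤ 1) {g k : S.GG} (hK : k ∈ C.K) (hB : k ∈ S.Bsub) :
    C.InKN j (g * k) ↔ C.InKN j g := by
  have key : ∀ {g k : S.GG}, k ∈ C.K → k ∈ S.Bsub → C.InKN j g → C.InKN j (g * k) := by
    rintro g k hK hB ⟨u, hu, h⟩
    refine ⟨_, C.conj_mem_NkSub hj hK hB hu, ?_⟩
    rw [show g * k * (k⁻¹ * u * k) = g * u * k by group]
    exact C.K.mul_mem h hK
  refine ⟨fun h => ?_, key hK hB⟩
  have := key (C.K.inv_mem hK) (S.Bsub.inv_mem hB) h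
  rwa [mul_inv_cancel_right] at this

lemma exists_of_inKN {j : ℤ} {b : S.GG} (hB : b ∈ S.Bsub) (h : C.InKN j b) :
    ∃ k ∈ C.K, k ∈ S.Bsub ∧ ∃ u ∈ S.NkSub j, b = k * u := by
  obtain ⟨u, hu, h⟩ := h
  exact ⟨_, h, S.Bsub.mul_mem hB (NkSub_le_Bsub _ hu), u⁻¹, inv_mem hu, by group⟩

end Chamber

end U21

namespace U21

namespace Chamber

open Setting

variable {S : Setting} (C : Chamber S) {R : Type} [Field R]

/-! ### The functions `f₀`, `f₀ + f₁` and `(T + 1) f₀` -/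

/-- The value of `f₀ + f₁` at `g`, where `v` is the value of `f₀` at `1`. -/
def sFn (v : R) (g : S.GG) : R :=
  (if g * S.alphaE ∈ C.K then v else 0) + if C.InKN (C.nK - 1) g then v else 0

/-- The value of `(T + 1) f₀` at `g * α`, where `v` is the value of `f₀` at `1`. -/
def tFn (v : R) (g : S.GG) : R :=
  C.sFn v (g * S.alphaE) + if C.InKN (C.nK - 2) g then v else 0

/-- The set `(K ∩ B) * N_j`. -/
def KBN (j : ℤ) : Set S.GG := {d | ∃ k ∈ C.K, k ∈ S.Bsub ∧ ∃ u ∈ S.NkSub j, d = k * u}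

variable {C}

lemma NkSub_subset_KBN {j : ℤ} {u : S.GG} (hu : u ∈ S.NkSub j) : u ∈ C.KBN j :=
  ⟨1, one_mem _, one_mem _, u, hu, (one_mul u).symm⟩

lemma lam_of_mem_KBN {j : ℤ} {d : S.GG} (hd : d ∈ C.KBN j) : lam d = 0 := by
  obtain ⟨k, hK, hB, u, hu, rfl⟩ := hd
  rw [lam_mul hB (NkSub_le_Bsub _ hu), C.lam_eq_zero hK hB, lam_of_mem_NkSub hu, add_zero]

lemma mem_KBN_of_inKN {j : ℤ} {b : S.GG} (hB : b ∈ S.Bsub) (h : C.InKN j b) : b ∈ C.KBN j :=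
  exists_of_inKN hB h

lemma lam_of_mul_alpha_mem {b : S.GG} (hB : b ∈ S.Bsub) (h : b * S.alphaE ∈ C.K) : lam b = 1 := by
  have := C.lam_eq_zero h (S.Bsub.mul_mem hB alpha_mem_Bsub)
  rw [lam_mul hB alpha_mem_Bsub, lam_alpha] at this
  omega

lemma sFn_ne_zero {v : R} {g : S.GG} (h : C.sFn v g ≠ 0) :
    g * S.alphaE ∈ C.K ∨ C.InKN (C.nK - 1) g := by
  by_contra! hn
  exact h (by rw [sFn, if_neg hn.1, if_neg hn.2, add_zero])

lemma tFn_ne_zero {v : R} {g : S.GG} (h : C.tFn v g ≠ 0) :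
    C.sFn v (g * S.alphaE) ≠ 0 ∨ C.InKN (C.nK - 2) g := by
  by_contra! hn
  exact h (by rw [tFn, hn.1, if_neg hn.2, add_zero])

lemma sFn_mul {v : R} {g d : S.GG} (hd : d ∈ C.KBN (C.nK - 1)) : C.sFn v (g * d) = C.sFn v g := by
  have hn := C.nK_eq
  obtain ⟨k, hK, hB, u, hu, rfl⟩ := hd
  rw [sFn, sFn, ← mul_assoc, mul_alpha_mem_iff_of_mem_NkSub (NkSub_mono (by omega) hu),
    mul_alpha_mem_iff hK hB, inKN_mul_iff hu, inKN_mul_iff_of_mem_K (by omega) hK hB]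

lemma tFn_mul {v : R} {g d : S.GG} (hd : d ∈ C.KBN (C.nK - 2)) : C.tFn v (g * d) = C.tFn v g := by
  have hn := C.nK_eq
  have hd' : S.alphaE⁻¹ * d * S.alphaE ∈ C.KBN (C.nK - 1) := by
    obtain ⟨k, hK, hB, u, hu, rfl⟩ := hd
    refine ⟨_, C.alpha_conj_mem_K hK hB, S.Bsub.mul_mem (S.Bsub.mul_mem
      (S.Bsub.inv_mem alpha_mem_Bsub) hB) alpha_mem_Bsub, _,
      NkSub_mono (by omega) (alpha_inv_conj_mem hu), by group⟩
  rw [tFn, tFn, show g * d * S.alphaE = g * S.alphaE * (S.alphaE⁻¹ * d * S.alphaE) by group,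
    sFn_mul hd']
  obtain ⟨k, hK, hB, u, hu, rfl⟩ := hd
  rw [← mul_assoc, inKN_mul_iff hu, inKN_mul_iff_of_mem_K (by omega) hK hB]

lemma sFn_one (v : R) : C.sFn v 1 = v := by
  have h : C.InKN (C.nK - 1) (1 : S.GG) := ⟨1, one_mem _, by simp⟩
  rw [sFn, if_pos h, if_neg, zero_add]
  exact fun hK => not_inKN_of_mul_alpha_mem hK h

lemma lam_of_sFn_ne_zero {v : R} {b : S.GG} (hB : b ∈ S.Bsub) (h : C.sFn v b ≠ 0) :
    0 ≤ lam b := by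
  rcases sFn_ne_zero h with h | h
  · rw [lam_of_mul_alpha_mem hB h]
    omega
  · rw [lam_of_mem_KBN (mem_KBN_of_inKN hB h)]

lemma lam_of_sFn_alpha_ne_zero {v : R} {b : S.GG} (hB : b ∈ S.Bsub)
    (h : C.sFn v (b * S.alphaE) ≠ 0) : 1 ≤ lam b := by
  have := lam_of_sFn_ne_zero (S.Bsub.mul_mem hB alpha_mem_Bsub) h
  rw [lam_mul hB alpha_mem_Bsub, lam_alpha] at this
  omega

lemma tFn_one (v : R) : C.tFn v 1 = v := by
  have h : C.InKN (C.nK - 2) (1 : S.GG) := ⟨1, one_mem _, by simp⟩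
  rw [tFn, if_pos h]
  convert zero_add v
  by_contra h0
  have := lam_of_sFn_alpha_ne_zero S.Bsub.one_mem h0
  rw [lam_of_mem_KBN (mem_KBN_of_inKN S.Bsub.one_mem h)] at this
  omega

variable (C) in
lemma exists_mem_NkSub_notMem (j : ℤ) : ∃ u ∈ S.NkSub j, u ∉ S.NkSub (j + 1) := by
  obtain ⟨d, hd0, hdv, hd⟩ := S.exists_trace_zero j
  refine ⟨nE 0 d (by simpa using hd), nE_mem.2 (S.mem_pE.2 (Or.inr hdv.ge)), ?_⟩
  rw [nE_mem, S.mem_pE]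
  push Not
  exact ⟨hd0, by omega⟩

/-- The function `f₀` is not a combination of `B`-translates of `f₀ + f₁`. -/
lemma indicator_notMem_span {v : R} (hv : v ≠ 0) :
    (fun g => if g ∈ C.K then v else 0) ∉
      Submodule.span R {s | ∃ b ∈ S.Bsub, s = fun x => C.sFn v (x * b)} := by
  intro hf
  have hzero : ∀ b ∈ S.Bsub, C.sFn v b ≠ 0 → lam b = 0 → b ∈ C.KBN (C.nK - 1) := by
    intro b hB hb h0
    rcases sFn_ne_zero hb with h | h
    · rw [lam_of_mul_alpha_mem hB h] at h0
      omega
    · exact mem_KBN_of_inKN hB h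
  obtain ⟨b, hB, hb0, hb⟩ := exists_constant_of_mem_span S.Bsub lam
    (fun a ha b hb => lam_mul ha hb) (C.sFn v) (C.KBN (C.nK - 1)) (S.NkSub (C.nK - 1))
    (NkSub_le_Bsub _) (fun u hu => lam_of_mem_NkSub hu) (fun u hu => NkSub_subset_KBN hu)
    (fun d hd g => sFn_mul hd) (fun b hB h => lam_of_sFn_ne_zero hB h) hzero
    (by rwa [sFn_one]) _ hf (fun h => hv (by simpa using congrFun h 1))
  obtain ⟨u, hu, hu'⟩ := exists_mem_NkSub_notMem (S := S) (C.nK - 1)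
  have hbK : b ∈ C.K := by
    by_contra h
    exact hb0 (if_neg h)
  have hubK : u * b ∈ C.K := by
    by_contra h
    exact hb0 ((hb u hu).symm.trans (if_neg h))
  rw [C.K.mul_mem_cancel_right hbK] at hubK
  rw [sub_add_cancel] at hu'
  exact hu' (C.mem_NkSub_of_mem_K hu hubK)

/-- The function `f₀ + f₁` is not a combination of `B`-translates of `(T + 1) f₀`. -/
lemma sFn_notMem_span {v : R} (hv : v ≠ 0) :
    C.sFn v ∉ Submodule.span R {s | ∃ b ∈ S.Bsub, s = fun x => C.tFn v (x * b)} := by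
  intro hf
  have hn := C.nK_eq
  have hpos : ∀ b ∈ S.Bsub, C.tFn v b ≠ 0 → 0 ≤ lam b := by
    intro b hB hb
    rcases tFn_ne_zero hb with h | h
    · have := lam_of_sFn_alpha_ne_zero hB h
      omega
    · rw [lam_of_mem_KBN (mem_KBN_of_inKN hB h)]
  have hzero : ∀ b ∈ S.Bsub, C.tFn v b ≠ 0 → lam b = 0 → b ∈ C.KBN (C.nK - 2) := by
    intro b hB hb h0
    rcases tFn_ne_zero hb with h | h
    · have := lam_of_sFn_alpha_ne_zero hB h
      omega
    · exact mem_KBN_of_inKN hB h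
  obtain ⟨b, hB, hb0, hb⟩ := exists_constant_of_mem_span S.Bsub lam
    (fun a ha b hb => lam_mul ha hb) (C.tFn v) (C.KBN (C.nK - 2)) (S.NkSub (C.nK - 2))
    (NkSub_le_Bsub _) (fun u hu => lam_of_mem_NkSub hu) (fun u hu => NkSub_subset_KBN hu)
    (fun d hd g => tFn_mul hd) hpos hzero
    (by rwa [tFn_one]) _ hf (fun h => hv (by simpa [sFn_one] using congrFun h 1))
  obtain ⟨w, hw, hw'⟩ := exists_mem_NkSub_notMem (S := S) (C.nK - 2)
  rw [show C.nK - 2 + 1 = C.nK - 1 by omega] at hw'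
  have key : ∀ k ∈ C.K, k ∈ S.Bsub → C.sFn v (k * w * k⁻¹ * b) ≠ 0 := by
    intro k hK hkB
    have := C.conj_mem_NkSub (by omega) (C.K.inv_mem hK) (S.Bsub.inv_mem hkB) hw
    rw [inv_inv] at this
    rwa [hb _ this]
  rcases sFn_ne_zero hb0 with h | h
  · have hkB := S.Bsub.mul_mem hB alpha_mem_Bsub
    have hlam := lam_of_mul_alpha_mem hB h
    have h1 := key _ h hkB
    rw [show b * S.alphaE * w * (b * S.alphaE)⁻¹ * b = b * S.alphaE * w * S.alphaE⁻¹ by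
      group] at h1
    rcases sFn_ne_zero h1 with h2 | h2
    · rw [inv_mul_cancel_right, C.K.mul_mem_cancel_left h] at h2
      exact hw' (NkSub_mono (by omega) (C.mem_NkSub_of_mem_K hw h2))
    · have hwB := NkSub_le_Bsub _ hw
      have hαB := S.Bsub.inv_mem (alpha_mem_Bsub (S := S))
      have h3 := lam_of_mem_KBN (mem_KBN_of_inKN
        (S.Bsub.mul_mem (S.Bsub.mul_mem hkB hwB) hαB) h2)
      rw [lam_mul (S.Bsub.mul_mem hkB hwB) hαB, lam_mul hkB hwB, lam_mul hB alpha_mem_Bsub,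
        lam_inv alpha_mem_Bsub, lam_of_mem_NkSub hw] at h3
      omega
  · obtain ⟨k, hK, hkB, u, hu, rfl⟩ := exists_of_inKN hB h
    have h1 := key k hK hkB
    rw [show k * w * k⁻¹ * (k * u) = k * (w * u) by group] at h1
    have hwu : w * u ∈ S.NkSub (C.nK - 2) := mul_mem hw (NkSub_mono (by omega) hu)
    rcases sFn_ne_zero h1 with h2 | h2
    · have h3 := lam_of_mul_alpha_mem (S.Bsub.mul_mem hkB (NkSub_le_Bsub _ hwu)) h2
      rw [lam_of_mem_KBN ⟨k, hK, hkB, _, hwu, rfl⟩] at h3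
      omega
    · obtain ⟨z, hz, h2⟩ := h2
      rw [mul_assoc, C.K.mul_mem_cancel_left hK] at h2
      have h3 := C.mem_NkSub_of_mem_K (mul_mem hwu (NkSub_mono (by omega) hz)) h2
      have h4 := mul_mem (NkSub_mono (by omega) h3 : _ ∈ S.NkSub (C.nK - 1))
        (inv_mem (mul_mem hu hz))
      rw [show w * u * z * (u * z)⁻¹ = w by group] at h4
      exact hw' h4

end Chamber

end U21

namespace U21

/-! ### Generalities on representations -/

section Generic

variable {𝔽 G₀ V : Type} [Field 𝔽] [Group G₀] [AddCommGroup V] [Module 𝔽 V]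
  {ρ : Representation 𝔽 G₀ V}

lemma mem_orbitSpan_apply {v w : V} (g : G₀) (hw : w ∈ orbitSpan 𝔽 ρ v) :
    ρ g w ∈ orbitSpan 𝔽 ρ v := by
  induction hw using Submodule.span_induction with
  | mem x hx =>
    obtain ⟨h, rfl⟩ := hx
    exact Submodule.subset_span ⟨g * h, by simp⟩
  | zero => simp
  | add x y _ _ hx hy => simpa using add_mem hx hy
  | smul a x _ hx => simpa using Submodule.smul_mem _ a hx

lemma orbitSpan_le {v w : V} (hw : w ∈ orbitSpan 𝔽 ρ v) : orbitSpan 𝔽 ρ w ≤ orbitSpan 𝔽 ρ v := by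
  rw [orbitSpan, Submodule.span_le]
  rintro _ ⟨g, rfl⟩
  exact mem_orbitSpan_apply g hw

/-- An equivariant map carries combinations of translates of `v` to those of its image. -/
lemma apply_mem_orbitSpanOn {A : Set G₀} {v w : V} {φ : Module.End 𝔽 V}
    (hφ : ∀ g x, φ (ρ g x) = ρ g (φ x)) (hw : w ∈ orbitSpanOn 𝔽 ρ A v) :
    φ w ∈ orbitSpanOn 𝔽 ρ A (φ v) := by
  induction hw using Submodule.span_induction with
  | mem x hx =>
    obtain ⟨g, hg, rfl⟩ := hx
    exact Submodule.subset_span ⟨g, hg, hφ g v⟩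
  | zero => simp
  | add x y _ _ hx hy => simpa using add_mem hx hy
  | smul a x _ hx => simpa using Submodule.smul_mem _ a hx

lemma orbitSpanOn_le_orbitSpan (A : Set G₀) (v : V) : orbitSpanOn 𝔽 ρ A v ≤ orbitSpan 𝔽 ρ v :=
  Submodule.span_mono fun _ ⟨g, _, h⟩ => ⟨g, h⟩

end Generic

open Setting

section Ind

variable {S : Setting} {C : Chamber S} {𝔽 : Type} [Field 𝔽]

variable (C 𝔽) in
/-- Compact induction of the trivial weight. -/
abbrev IndTriv : Submodule 𝔽 (S.GG → 𝔽) := IndSub C 𝔽 𝔽 (1 : Representation 𝔽 C.K 𝔽)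

variable (C 𝔽) in
/-- The action of `G` on the compact induction of the trivial weight. -/
abbrev indTrivRep : Representation 𝔽 S.GG (IndTriv C 𝔽) :=
  indRep C 𝔽 𝔽 (1 : Representation 𝔽 C.K 𝔽)

lemma indRep_apply (g : S.GG) (f : IndTriv C 𝔽) (x : S.GG) :
    (indTrivRep C 𝔽 g f : S.GG → 𝔽) x = (f : S.GG → 𝔽) (x * g) := rfl

lemma ind_mul_left (f : IndTriv C 𝔽) {k : S.GG} (hk : k ∈ C.K) (x : S.GG) :
    (f : S.GG → 𝔽) (k * x) = (f : S.GG → 𝔽) x := by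
  simpa using f.2.1 k hk x

/-- By the Iwasawa decomposition, the translates by `B` of a vector invariant under `N_c` and
`N'_{-c}` are all its translates. -/
lemma orbitSpan_le_orbitSpanOn_Bsub {V : Type} [AddCommGroup V] [Module 𝔽 V]
    {ρ : Representation 𝔽 S.GG V} {v : V} (c : ℤ) (h1 : ∀ u ∈ S.NkSub c, ρ u v = v)
    (h2 : ∀ n ∈ S.N'k (-c), ρ n v = v) : orbitSpan 𝔽 ρ v ≤ orbitSpanOn 𝔽 ρ S.Bsub v := by
  rw [orbitSpan, Submodule.span_le]
  rintro _ ⟨g, rfl⟩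
  obtain ⟨u, hu, n, hn, hb⟩ := exists_mul_mem_Bsub c g
  refine Submodule.subset_span ⟨_, hb, ?_⟩
  rw [map_mul, map_mul, Module.End.mul_apply, Module.End.mul_apply, h2 n hn, h1 u hu]

lemma coe_mem_span_of_mem_orbitSpanOn {A : Set S.GG} {f x : IndTriv C 𝔽}
    (hx : x ∈ orbitSpanOn 𝔽 (indTrivRep C 𝔽) A f) :
    (x : S.GG → 𝔽) ∈ Submodule.span 𝔽 {s | ∃ b ∈ A, s = fun y => (f : S.GG → 𝔽) (y * b)} := by
  induction hx using Submodule.span_induction with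
  | mem x hx =>
    obtain ⟨b, hb, rfl⟩ := hx
    exact Submodule.subset_span ⟨b, hb, rfl⟩
  | zero => exact Submodule.zero_mem _
  | add x y _ _ hx hy => exact add_mem hx hy
  | smul a x _ hx => exact Submodule.smul_mem _ a hx

/-- The compact induction is generated by the indicator function of `K`. -/
lemma mem_orbitSpan_of_eq_indicator {v : 𝔽} (hv : v ≠ 0) {f : IndTriv C 𝔽}
    (hf : ∀ g, (f : S.GG → 𝔽) g = if g ∈ C.K then v else 0) (x : IndTriv C 𝔽) :
    x ∈ orbitSpan 𝔽 (indTrivRep C 𝔽) f := by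
  obtain ⟨s, hs⟩ := x.2.2
  induction s using Finset.induction_on generalizing x with
  | empty =>
    convert Submodule.zero_mem _
    apply Subtype.ext
    funext g
    by_contra h
    obtain ⟨k, -, t, ht, -⟩ := hs g h
    simp at ht
  | insert t s _ ih =>
    set c := (x : S.GG → 𝔽) t / v
    have hy := ih (x - c • indTrivRep C 𝔽 t⁻¹ f) ?_
    · have := add_mem hy (Submodule.smul_mem _ c
        (Submodule.subset_span ⟨t⁻¹, rfl⟩ : indTrivRep C 𝔽 t⁻¹ f ∈ orbitSpan 𝔽 (indTrivRep C 𝔽) f))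
      rwa [sub_add_cancel] at this
    · intro g hg
      have e : ((x - c • indTrivRep C 𝔽 t⁻¹ f : IndTriv C 𝔽) : S.GG → 𝔽) g =
        (x : S.GG → 𝔽) g - c * if g * t⁻¹ ∈ C.K then v else 0 := by
        rw [← hf]
        rfl
      rw [e] at hg
      by_cases h : g * t⁻¹ ∈ C.K
      · refine absurd ?_ hg
        have := ind_mul_left x h t
        rw [inv_mul_cancel_right] at this
        rw [if_pos h, this, div_mul_cancel₀ _ hv, sub_self]
      · rw [if_neg h, mul_zero, sub_zero] at hg
        obtain ⟨k, hk, t', ht', rfl⟩ := hs g hg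
        rcases Finset.mem_insert.1 ht' with rfl | ht'
        · rw [mul_inv_cancel_right] at h
          exact absurd hk h
        · exact ⟨k, hk, t', ht', rfl⟩

lemma sigma'_trivial (g : S.GG) : sigma' C 𝔽 𝔽 (1 : Representation 𝔽 C.K 𝔽) g = 1 := by
  rw [sigma']
  split_ifs <;> rfl

lemma stdFn_trivial (g : S.GG) (v : 𝔽) (x : S.GG) :
    stdFn C 𝔽 𝔽 (1 : Representation 𝔽 C.K 𝔽) g v x = if x * g ∈ C.K then v else 0 := by
  rw [stdFn]
  split_ifs <;> rfl

section FFamily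

variable {v0 : 𝔽} {ff : ℤ → IndTriv C 𝔽}

lemma ff_zero_apply (hff : IsFFamily C 𝔽 𝔽 (1 : Representation 𝔽 C.K 𝔽) v0 ff) (g : S.GG) :
    (ff 0 : S.GG → 𝔽) g = if g ∈ C.K then v0 else 0 := by
  obtain ⟨-, -, -, hsupp, -, hval⟩ := hff
  split_ifs with h
  · have h1 := hval 0 le_rfl
    rw [neg_zero, zpow_zero] at h1
    rw [← h1, ← ind_mul_left (ff 0) h 1, mul_one]
  · by_contra h0
    obtain ⟨k, hk, i, hi, rfl⟩ := hsupp 0 g h0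
    rw [neg_zero, zpow_zero, mul_one] at h
    exact h (C.K.mul_mem hk (C.mem_K_of_mem_I1 hi))

lemma ff_one_apply (hff : IsFFamily C 𝔽 𝔽 (1 : Representation 𝔽 C.K 𝔽) v0 ff) (g : S.GG) :
    (ff 1 : S.GG → 𝔽) g = if C.InOpp g then v0 else 0 := by
  obtain ⟨-, -, hinv, hsupp, hval, -⟩ := hff
  split_ifs with h
  · obtain ⟨n, hn, h⟩ := h
    have h1 := hval 1 one_pos
    rw [sigma'_trivial, Module.End.one_apply, zpow_neg_one] at h1
    rw [← h1, ← hinv 1 n (C.N'k_subset_I1 hn), indRep_apply,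
      show g * n = g * n * S.alphaE * S.alphaE⁻¹ by group, ind_mul_left _ h,
      hinv 1 n (C.N'k_subset_I1 hn)]
  · by_contra h0
    obtain ⟨k, hk, i, hi, rfl⟩ := hsupp 1 g h0
    have hi' := C.mem_I1.1 hi
    have h22 : S.mat i 2 2 ≠ 0 ∧ S.val (S.mat i 2 2) = 0 := by
      by_contra hc
      have h1 : S.mat i 2 2 ∈ S.pE 1 := by
        rw [not_and] at hc
        by_cases h0 : S.mat i 2 2 = 0
        · exact S.mem_pE.2 (Or.inl h0)
        · have h2 := (S.mem_pE.1 (C.mem_K.1 hi'.1).2.2.2.2).resolve_left h0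
          have h3 := hc h0
          exact S.mem_pE.2 (Or.inr (by omega))
      refine S.one_notMem_pE one_pos ?_
      rw [show (1 : S.E) = S.mat i 2 2 + -(S.mat i 2 2 - 1) by ring]
      exact pE_add h1 (pE_neg hi'.2.2.2.2)
    have hr : S.mat i 2 0 / S.mat i 2 2 ∈ S.pE (1 - C.nK) := by
      rw [div_eq_mul_inv]
      refine pE_mul hi'.2.1.2.1 (k := 0) (S.mem_pE.2 (Or.inr ?_)) (by omega)
      rw [S.val_inv, h22.2, neg_zero]
    obtain ⟨n, hn, hb⟩ := exists_mul_N'k_mem_Bsub i h22.1 hr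
    refine h ⟨n, hn, ?_⟩
    rw [zpow_neg_one, show k * S.alphaE⁻¹ * i * n * S.alphaE =
      k * (S.alphaE⁻¹ * (i * n) * S.alphaE) by group]
    exact C.K.mul_mem hk (C.alpha_conj_mem_K
      (C.K.mul_mem hi'.1 (C.mem_K_of_mem_I1 (C.N'k_subset_I1 hn))) hb)

lemma ite_add_ite {P Q P' Q' : Prop} (h : P ∨ Q ↔ P' ∨ Q') (hPQ : P → ¬Q) (hPQ' : P' → ¬Q')
    (v : 𝔽) : (if P then v else 0) + (if Q then v else 0) =
      (if P' then v else 0) + if Q' then v else 0 := by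
  by_cases P <;> by_cases Q <;> by_cases P' <;> by_cases Q' <;> simp_all

lemma ff_add_apply (hff : IsFFamily C 𝔽 𝔽 (1 : Representation 𝔽 C.K 𝔽) v0 ff) (g : S.GG) :
    ((ff 0 + ff 1 : IndTriv C 𝔽) : S.GG → 𝔽) g = C.sFn v0 g := by
  rw [Submodule.coe_add, Pi.add_apply, ff_zero_apply hff, ff_one_apply hff, Chamber.sFn]
  exact ite_add_ite (Chamber.mem_or_inOpp_iff g) Chamber.not_inOpp_of_mem
    Chamber.not_inKN_of_mul_alpha_mem v0

variable {T : Module.End 𝔽 (IndTriv C 𝔽)}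

lemma hecke_ff_zero_apply (hff : IsFFamily C 𝔽 𝔽 (1 : Representation 𝔽 C.K 𝔽) v0 ff)
    (hT : IsHeckeT C 𝔽 𝔽 (1 : Representation 𝔽 C.K 𝔽) LinearMap.id T) (g : S.GG) :
    (T (ff 0) : S.GG → 𝔽) g =
      (if C.InAlpha g then v0 else 0) + if C.InOpp g then v0 else 0 := by
  obtain ⟨U2, hU2, -⟩ := exists_isReps (S := S) C.nK 2
  obtain ⟨U1, hU1, -⟩ := exists_isReps (S := S) (C.nK + 1) 1
  rw [show C.nK + 1 + 1 = C.nK + 2 by omega] at hU1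
  rw [hT.2 v0 (ff 0) (by
    funext x
    rw [stdFn_trivial, mul_one, ff_zero_apply hff]) U2 U1 hU2 hU1]
  simp only [sigma'_trivial, Module.End.one_apply, LinearMap.id_apply, Pi.add_apply,
    Finset.sum_apply, stdFn_trivial, ← mul_assoc]
  rw [sum_ite_of_isReps hU2 (fun u => g * u * S.alphaE⁻¹ ∈ C.K),
    sum_ite_of_isReps hU1 (fun u => g * C.βK * u * S.alphaE⁻¹ ∈ C.K)]
  · simp only [Chamber.exists_βK_mul_iff]
    rfl
  · exact fun a _ b hb h => Chamber.mul_mul_alpha_inv_mem hb h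
  · exact fun a ha b hb h h' => Chamber.inv_mul_mem_of_mul_alpha_inv_mem ha hb h h'
  · exact fun a _ b hb h => Chamber.mul_mul_alpha_inv_mem hb h
  · exact fun a ha b hb h h' => Chamber.inv_mul_mem_of_mul_alpha_inv_mem ha hb h h'

lemma hecke_add_one_apply (hff : IsFFamily C 𝔽 𝔽 (1 : Representation 𝔽 C.K 𝔽) v0 ff)
    (hT : IsHeckeT C 𝔽 𝔽 (1 : Representation 𝔽 C.K 𝔽) LinearMap.id T) (g : S.GG) :
    ((T + 1) (ff 0) : S.GG → 𝔽) g = C.sFn v0 g + if C.InAlpha g then v0 else 0 := by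
  rw [← ff_add_apply hff, LinearMap.add_apply, Module.End.one_apply, Submodule.coe_add,
    Submodule.coe_add, Pi.add_apply, Pi.add_apply, hecke_ff_zero_apply hff hT, ff_one_apply hff]
  ring

lemma hecke_add_one_apply_mul_alpha
    (hff : IsFFamily C 𝔽 𝔽 (1 : Representation 𝔽 C.K 𝔽) v0 ff)
    (hT : IsHeckeT C 𝔽 𝔽 (1 : Representation 𝔽 C.K 𝔽) LinearMap.id T) (g : S.GG) :
    ((T + 1) (ff 0) : S.GG → 𝔽) (g * S.alphaE) = C.tFn v0 g := by
  rw [hecke_add_one_apply hff hT, Chamber.tFn]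
  congr 2
  rw [eq_iff_iff]
  constructor
  · rintro ⟨u, hu, h⟩
    refine ⟨_, alpha_conj_mem hu, ?_⟩
    rwa [show g * (S.alphaE * u * S.alphaE⁻¹) = g * S.alphaE * u * S.alphaE⁻¹ by group]
  · rintro ⟨u, hu, h⟩
    refine ⟨_, alpha_inv_conj_mem hu, ?_⟩
    rwa [show g * S.alphaE * (S.alphaE⁻¹ * u * S.alphaE) * S.alphaE⁻¹ = g * u by group]

lemma hecke_add_one_equivariant
    (hT : IsHeckeT C 𝔽 𝔽 (1 : Representation 𝔽 C.K 𝔽) LinearMap.id T) (g : S.GG)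
    (x : IndTriv C 𝔽) : (T + 1) (indTrivRep C 𝔽 g x) = indTrivRep C 𝔽 g ((T + 1) x) := by
  simp [hT.1]

/-- The vector `(T + 1) f₀` lies in the subrepresentation generated by `f₀ + f₁`. -/
lemma hecke_add_one_mem_orbitSpan [Algebra (ZMod S.p) 𝔽]
    (hff : IsFFamily C 𝔽 𝔽 (1 : Representation 𝔽 C.K 𝔽) v0 ff)
    (hT : IsHeckeT C 𝔽 𝔽 (1 : Representation 𝔽 C.K 𝔽) LinearMap.id T) :
    (T + 1) (ff 0) ∈ orbitSpan 𝔽 (indTrivRep C 𝔽) (ff 0 + ff 1) := by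
  obtain ⟨U, hU, hcard⟩ := exists_isReps (S := S) C.nK 1
  have hU0 : (U.card : 𝔽) = 0 := by
    obtain ⟨m, hm⟩ := S.p_dvd_card_NkQuot C.nK
    have hp : ((S.p : ℕ) : 𝔽) = 0 := by
      rw [← map_natCast (algebraMap (ZMod S.p) 𝔽), ZMod.natCast_self, map_zero]
    rw [hcard, hm, Nat.cast_mul, hp, zero_mul]
  have e : (T + 1) (ff 0) =
      (ff 0 + ff 1) + ∑ u ∈ U, indTrivRep C 𝔽 (u * S.alphaE⁻¹) (ff 0 + ff 1) := by
    apply Subtype.ext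
    funext g
    rw [hecke_add_one_apply hff hT, Submodule.coe_add, Pi.add_apply, ff_add_apply hff,
      Submodule.coe_sum, Finset.sum_apply]
    simp only [indRep_apply, ff_add_apply hff]
    congr 1
    have h1 : ∑ u ∈ U, (if g * (u * S.alphaE⁻¹) * S.alphaE ∈ C.K then v0 else 0) = 0 := by
      have h (u) (hu : u ∈ U) : (if g * (u * S.alphaE⁻¹) * S.alphaE ∈ C.K then v0 else 0) =
          if g ∈ C.K then v0 else 0 := by
        rw [← mul_assoc, inv_mul_cancel_right,
          C.K.mul_mem_cancel_right (C.NkSub_le_K le_rfl (hU.1 (Finset.mem_coe.2 hu)))]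
      rw [Finset.sum_congr rfl h, Finset.sum_const, nsmul_eq_mul, hU0, zero_mul]
    simp only [Chamber.sFn]
    rw [Finset.sum_add_distrib, h1, zero_add]
    simp only [← mul_assoc]
    rw [sum_ite_of_isReps hU (fun u => C.InKN (C.nK - 1) (g * u * S.alphaE⁻¹))]
    · simp only [Chamber.exists_inKN_iff]
    · exact fun a _ b hb h => Chamber.inKN_mul_mul_alpha_inv hb h
    · exact fun a ha b hb h h' => Chamber.inv_mul_mem_of_inKN ha hb h h'
  have hs : ff 0 + ff 1 ∈ orbitSpan 𝔽 (indTrivRep C 𝔽) (ff 0 + ff 1) :=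
    Submodule.subset_span ⟨1, by simp⟩
  rw [e]
  exact add_mem hs (sum_mem fun u _ => Submodule.subset_span ⟨_, rfl⟩)

lemma mem_orbitSpanOn_Bsub_ff_zero (hff : IsFFamily C 𝔽 𝔽 (1 : Representation 𝔽 C.K 𝔽) v0 ff)
    (x : IndTriv C 𝔽) : x ∈ orbitSpanOn 𝔽 (indTrivRep C 𝔽) S.Bsub (ff 0) := by
  have hK (k) (hk : k ∈ C.K) : indTrivRep C 𝔽 k (ff 0) = ff 0 := by
    apply Subtype.ext
    funext g
    rw [indRep_apply, ff_zero_apply hff, ff_zero_apply hff, C.K.mul_mem_cancel_right hk]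
  refine orbitSpan_le_orbitSpanOn_Bsub C.nK (fun u hu => hK u (C.NkSub_le_K le_rfl hu))
    (fun n hn => hK n ?_) (mem_orbitSpan_of_eq_indicator hff.1 (ff_zero_apply hff) x)
  obtain ⟨x, y, h, hy, rfl⟩ := mem_N'k.1 hn
  exact C.n'E_mem_K hy

lemma orbitSpan_ff_add_le (hff : IsFFamily C 𝔽 𝔽 (1 : Representation 𝔽 C.K 𝔽) v0 ff) :
    orbitSpan 𝔽 (indTrivRep C 𝔽) (ff 0 + ff 1) ≤
      orbitSpanOn 𝔽 (indTrivRep C 𝔽) S.Bsub (ff 0 + ff 1) := by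
  refine orbitSpan_le_orbitSpanOn_Bsub (C.nK - 1) (fun u hu => ?_) fun n hn => ?_
  · apply Subtype.ext
    funext g
    rw [indRep_apply, ff_add_apply hff, ff_add_apply hff,
      Chamber.sFn_mul (Chamber.NkSub_subset_KBN hu)]
  · rw [neg_sub] at hn
    have h := C.N'k_subset_I1 hn
    rw [map_add, hff.2.2.1 0 n h, hff.2.2.1 1 n h]

lemma range_hecke_add_one_le [Algebra (ZMod S.p) 𝔽]
    (hff : IsFFamily C 𝔽 𝔽 (1 : Representation 𝔽 C.K 𝔽) v0 ff)
    (hT : IsHeckeT C 𝔽 𝔽 (1 : Representation 𝔽 C.K 𝔽) LinearMap.id T) :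
    LinearMap.range (T + 1) ≤ orbitSpan 𝔽 (indTrivRep C 𝔽) (ff 0 + ff 1) := by
  rintro _ ⟨x, rfl⟩
  exact orbitSpan_le (hecke_add_one_mem_orbitSpan hff hT) (orbitSpanOn_le_orbitSpan _ _
    (apply_mem_orbitSpanOn (hecke_add_one_equivariant hT) (mem_orbitSpanOn_Bsub_ff_zero hff x)))

end FFamily

end Ind

end U21
namespace U21

/-- The image of `f₀ + f₁` in `(ind_K^G 1)/(T+1)` is nonzero but does not
generate `(ind_K^G 1)/(T+1)`. -/
theorem stmt5
    (S : Setting) (C : Chamber S)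
    (𝔽 : Type) [Field 𝔽] [IsAlgClosed 𝔽] [Algebra (ZMod S.p) 𝔽]
    [Algebra.IsAlgebraic (ZMod S.p) 𝔽]
    (v0 : 𝔽) (ff : ℤ → ↥(IndSub C 𝔽 𝔽 (1 : Representation 𝔽 ↥C.K 𝔽)))
    (hff : IsFFamily C 𝔽 𝔽 (1 : Representation 𝔽 ↥C.K 𝔽) v0 ff)
    (Ttr : Module.End 𝔽 ↥(IndSub C 𝔽 𝔽 (1 : Representation 𝔽 ↥C.K 𝔽)))
    (hTtr : IsHeckeT C 𝔽 𝔽 (1 : Representation 𝔽 ↥C.K 𝔽) LinearMap.id Ttr) :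
    ff 0 + ff 1 ∉ LinearMap.range (Ttr + 1) ∧
    orbitSpan 𝔽 (indRep C 𝔽 𝔽 (1 : Representation 𝔽 ↥C.K 𝔽)) (ff 0 + ff 1) ⊔
      LinearMap.range (Ttr + 1) ≠ ⊤ := by
  constructor
  · rintro ⟨x, hx⟩
    have h := coe_mem_span_of_mem_orbitSpanOn (apply_mem_orbitSpanOn
      (hecke_add_one_equivariant hTtr) (mem_orbitSpanOn_Bsub_ff_zero hff x))
    rw [hx, funext (ff_add_apply hff)] at h
    refine Chamber.sFn_notMem_span hff.1 (Submodule.span_mono ?_ h)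
    rintro _ ⟨b, hb, rfl⟩
    refine ⟨b * S.alphaE⁻¹, S.Bsub.mul_mem hb (S.Bsub.inv_mem S.alpha_mem_Bsub), ?_⟩
    funext y
    rw [← hecke_add_one_apply_mul_alpha hff hTtr, mul_assoc, inv_mul_cancel_right]
  · intro h
    rw [sup_eq_left.2 (range_hecke_add_one_le hff hTtr)] at h
    have h0 := coe_mem_span_of_mem_orbitSpanOn (orbitSpan_ff_add_le hff
      (h ▸ Submodule.mem_top : ff 0 ∈ _))
    simp only [ff_add_apply hff] at h0
    rw [funext (ff_zero_apply hff)] at h0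
    exact Chamber.indicator_notMem_span hff.1 h0

end U21
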